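/- arXiv:1504.02403 — 7 statements merged into one kernel-verified Lean document; each statement's English description precedes it below -/
import Mathlib

section
/- R(4,13) ≥ 138; that is, there exists a 2-coloring of the edges of the complete graph K_137 containing no monochromatic K_4 in color 1 and no monochromatic K_13 in color 2. -/
namespace R413

/-- The doubled bit pattern of the nonzero cubes modulo 127: bit p is set iff p mod 127 is a nonzero cube. -/
def cub : Nat := 24566767210040744731345575799329122224284849085888680824730693462986445096246

/-- The adjacency matrix of the graph on 137 vertices, row a occupying the bits 137 a, ..., 137 a + 136. -/
def tbl : Nat := 0xdd04082813001804881400a18053499400b70029b28a09010c2811200804880420816ccd00030818102240b00910286140008698b181082813205804c814202190526990146808610320a6da08261410a04c0068120c1f02040812813205042860105b6504c206c30c2813201a00c81430a1904221801109b1536594130a10402200a409800821412168826db2802043020488128132040c20241fa01008004080010080010208041a0010832d94130a18502640b4099028614320a6c94b6504c2861409902d02640a1850c829a406d94130a18502640b4099028614320a6111b6504c2861409902d02640a1850c829d816d94130a18502640b4099028614320a40adb6504c2861409902d02640a1850c8280636d94130a18502640b4099028614320a090db6504c2861409902d02640a1850c82a2536d94130a18502640b40990286143208074db6504c2861409902d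02640a1850c8282536d94130a18502640b40990286143209294db6504c2861409902d02640a1850c8044536d94130a18502640b40990286143212c14db6504c2861409902d02640a1850c8810536d94130a18502640b40990286143205814db6504c2861409902d02640a1850ca890536d94130a18502640b40990286143302414db6504c2861409902d02640a1850c1190536d94130a18502640b40990286143a12414db6504c2861409902d02640a1850b1190536d94130a18502640b40990286140066414db6504c2861409902d02640a1850a8190536d94130a18502640b40990286140286414db6504c2861409902d02640a185090190536d94130a18502640b4099028614a086414db6504c2861409902d02640a185902190536d94130a18502640b40990286103286414db6504c2861409902d02640a18200a190536d94130a18502640b40990286230286414db6504c2861409902d02640a19020a190536d94130a18502640b40990286114286414db6504c2861409902d02640a19210a190536d94130a18502640b4099028482c286414db6504c2861409902d02640a0a830a190536d94130a18502640b4099028180c286414db6504c2861409902d02640a01830a190536d94130a18502640b4099029280c286414db6504c2861409902d02640a22c30a190536d94130a18502640b4099020210c286414db6504c2861409902d02640945430a190536d94130a18502640b4099003050c286414db6504c2861409902d02641001430a190536d94130a18502640b4099089050c286414db6504c2861409902d02640601430a190536d94130a18502640b4099152050c286414db6504c2861409902d02641101430a190536d94130a18502640b4099382050c286414db6504c2861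409902d0260a081430a190536d94130a18502640b40982c2050c286414db6504c2861409902d02684481430a190536d94130a18502640b4096032050c286414db6504c2861409902d02400c81430a190536d94130a18502640b4080b32050c286414db6504c2861409902d02404c81430a190536d94130a18502640b408c132050c286414db6504c2861409902d02004c81430a190536d94130a18502640b4050132050c286414db6504c2861409902d08204c81430a190536d94130a18502640b4800132050c286414db6504c2861409902d09404c81430a190536d94130a18502640b4e08132050c286414db6504c2861409902c06a04c81430a190536d94130a18502640b24a8132050c286414db6504c28614099029c1a04c81430a190536d94130a1850264092068132050c286414db6504c2861409903005a04c81430a190536d94130a1850264002968132050c286414db6504c2861409904305a04c81430a190536d94130a1850264100168132050c286414db6504c2861409901805a04c81430a190536d94130a1850264100168132050c286414db6504c2861409924805a04c81430a190536d94130a1850264c88168132050c286414db6504c2861409803205a04c81430a190536d94130a1850260608168132050c286414db6504c2861409921205a04c81430a190536d94130a18502407c8168132050c286414db6504c2861408303205a04c81430a190536d94130a18502808c8168132050c286414db6504c2861409113205a04c81430a190536d94130a18502084c8168132050c286414db6504c2861408013205a04c81430a190536d94130a18500804c8168132050c286414db6504c2861401a13205a04c81430a190536d94130a18503004c8168132050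c286414db6504c2861521013205a04c81430a190536d94130a185a1204c8168132050c286414db6504c2861008813205a04c81430a190536d94130a18482a04c8168132050c286414db6504c286005a813205a04c81430a190536d94130a18540a04c8168132050c286414db6504c2860c02813205a04c81430a190536d94130a18120a04c8168132050c286414db6504c286c842813205a04c81430a190536d94130a13a30a04c8168132050c286414db6504c28460c2813205a04c81430a190536d94130a01030a04c8168132050c286414db6504c29800c2813205a04c81430a190536d94130a06430a04c8168132050c286414db6504c292d0c2813205a04c81430a190536d94130a40430a04c8168132050c286414db6504c34050c2813205a04c81430a190536d94130141430a04c8168132050c286414db6504c41050c2813205a04c81430a190536d94130191430a04c8168132050c286414db6504c22850c2813205a04c81430a190536d9413c0a1430a04c8168132050c286414db6504847850c2813205a04c81430a190536d94106061430a04c8168132050c286414db6505201850c2813205a04c81430a190536d9418d261430a04c8168132050c286414db6502809850c2813205a04c81430a190536d94006261430a04c8168132050c286414db6510809850c2813205a04c81430a190536d94140261430a04c8168132050c286414db6549009850c2813205a04c81430a190536d94808261430a04c8168132050c286414db6490209850c2813205a04c81430a190536d91128261430a04c8168132050c286414db6030a09850c2813205a04c81430a190536d82328261430a04c8168132050c2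86414db6424a09850c2813205a04c81430a190536d20328261430a04c8168132050c286414db004ca09850c2813205a04c81430a190536d88b28261430a04c8168132050c286414da00eca09850c2813205a04c81430a190536

def low (R : Nat) : Nat := Nat.xor R (Nat.land R (Nat.sub R 1))
def row (t : Nat) : Nat := Nat.shiftRight (Nat.mul cub t) 127
def s3 (Q R t : Nat) : Nat := Nat.xor (Nat.xor Q t) (low (Nat.land R (row t)))
def s2 (Q R : Nat) : Nat := s3 Q R (low R)
def s1 (Q t : Nat) : Nat := s2 (Nat.xor Q t) (Nat.land Q (row t))
def cover (n : Nat) : Nat → Nat :=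
  Nat.rec (motive := fun _ => Nat → Nat) (fun Q => Q)
    (fun _ ih Q => Nat.rec (motive := fun _ => Nat) 0 (fun _ _ => ih (s1 Q (low Q))) Q) n
def cut (P t : Nat) : Nat := Nat.xor P (Nat.land P (row t))
def both (a b : Bool) : Bool := Bool.rec (motive := fun _ => Bool) false b a
def body (s : Nat → Bool) (ih : Nat → Nat → Bool) (Q P1 t : Nat) : Bool :=
  both (s (cut P1 t)) (ih (Nat.xor Q t) P1)
def loop (s : Nat → Bool) (fuel : Nat) : Nat → Nat → Bool :=
  Nat.rec (motive := fun _ => Nat → Nat → Bool) (fun _ _ => false)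
    (fun _ ih Q P => Nat.rec (motive := fun _ => Bool) true
       (fun _ _ => body s ih Q (Nat.xor P (low Q)) (low Q)) Q) fuel
def search (need : Nat) : Nat → Bool :=
  Nat.rec (motive := fun _ => Nat → Bool) (fun _ => false)
    (fun k s P => Nat.rec (motive := fun _ => Bool) false
      (fun P _ => loop s 127 (cover k P) P) (Nat.add P 1)) need

/-- Row of the table. -/
def trow (a : Nat) : Nat := Nat.shiftRight tbl (Nat.mul 137 a)
def bit (a b : Nat) : Bool := Nat.beq (Nat.land 1 (Nat.shiftRight (trow a) b)) 1

/-- Bounded universal quantifier. -/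
def allB (f : Nat → Bool) (n : Nat) : Bool :=
  Nat.rec (motive := fun _ => Bool) true (fun i ih => both (f i) ih) n
def imp (a b : Bool) : Bool := Bool.rec (motive := fun _ => Bool) true b a

def chkD (a b c : Nat) : Bool :=
  Nat.beq (Nat.mod (Nat.land (Nat.land (trow a) (trow b)) (trow c)) (Nat.pow 2 c)) 0
def chkC (a b : Nat) : Bool := allB (fun c => imp (both (bit a c) (bit b c)) (chkD a b c)) b
def chkB (a : Nat) : Bool := allB (fun b => imp (bit a b) (chkC a b)) a
def chkA : Bool := allB chkB 137

def chkE : Bool := allB (fun a => allB (fun b =>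
  imp (bit a b == false) (Nat.beq (Nat.land 1 (Nat.shiftRight cub (127 + b - a))) 0 &&
    Nat.beq (Nat.land 1 (Nat.shiftRight cub (127 + a - b))) 0)) a) 127

def take (P u : Nat) : Nat := Nat.xor P (Nat.land P (trow u))

/-- Branch over the ten extra vertices 127, ..., 136. -/
def go (n : Nat) : Nat → Nat → Bool :=
  Nat.rec (motive := fun _ => Nat → Nat → Bool)
    (fun need P => imp (Nat.ble need 11) (search need (Nat.land P (2 ^ 127 - 1))))
    (fun n ih need P => both (ih need P)
      (imp (Nat.beq (Nat.land 1 (Nat.shiftRight P (Nat.add 127 n))) 1)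
        (ih (Nat.sub need 1) (take P (Nat.add 127 n))))) n

theorem run_K4 : chkA = true := by decide +kernel
theorem run_E : chkE = true := by decide +kernel
theorem run_base : search 11 (cut (2 ^ 127 - 2) 1) = true := by decide +kernel
theorem go_step {n need P : Nat} (h1 : go n need P = true)
    (h2 : go n (Nat.sub need 1) (take P (Nat.add 127 n)) = true) : go (n + 1) need P = true := by
  change both (go n need P) (imp _ (go n (Nat.sub need 1) (take P (Nat.add 127 n)))) = true
  rw [h1, h2]
  generalize Nat.beq (Nat.land 1 (Nat.shiftRight P (Nat.add 127 n))) 1 = b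
  cases b <;> rfl

/-- Candidates left once the extra vertex 127 + n has been chosen. -/
def cand (n : Nat) : Nat := take (2 ^ 137 - 1) (Nat.add 127 n)

theorem run_0 : go 0 12 (cand 0) = true := by decide +kernel
theorem run_1 : go 1 12 (cand 1) = true := by decide +kernel
theorem run_2 : go 2 12 (cand 2) = true := by decide +kernel
theorem run_3 : go 3 12 (cand 3) = true := by decide +kernel
theorem run_4 : go 4 12 (cand 4) = true := by decide +kernel
theorem run_5 : go 5 12 (cand 5) = true := by decide +kernel
theorem run_6 : go 6 12 (cand 6) = true := by decide +kernel
theorem run_7 : go 7 12 (cand 7) = true := by decide +kernel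
theorem run_8 : go 8 12 (cand 8) = true := by decide +kernel
theorem run_9 : go 9 12 (cand 9) = true := by decide +kernel
theorem run_start : go 0 13 (2 ^ 137 - 1) = true := by decide +kernel

theorem run_go : go 10 13 (2 ^ 137 - 1) = true :=
  go_step (go_step (go_step (go_step (go_step (go_step (go_step (go_step (go_step (go_step
    run_start run_0) run_1) run_2) run_3) run_4) run_5) run_6) run_7) run_8) run_9

theorem run_per : ∀ p < 254, cub.testBit p = cub.testBit (p % 127) := by decide +kernel

theorem low_zero : low 0 = 0 := by decide

theorem low_double (m : Nat) : low (2 * m) = 2 * low m := by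
  apply Nat.eq_of_testBit_eq
  intro i
  change (2 * m ^^^ (2 * m &&& (2 * m - 1))).testBit i = (2 * (m ^^^ (m &&& (m - 1)))).testBit i
  rcases Nat.eq_zero_or_pos m with rfl | hm
  · simp
  have h1 : 2 * m - 1 = 2 * (m - 1) + 1 := by omega
  rw [h1]
  cases i with
  | zero => simp
  | succ i =>
    simp only [Nat.testBit_xor, Nat.testBit_and]
    simp only [Nat.testBit_succ]
    have e1 : 2 * m / 2 = m := by omega
    have e2 : (2 * (m - 1) + 1) / 2 = m - 1 := by omega
    have e3 : 2 * (m ^^^ (m &&& (m - 1))) / 2 = (m ^^^ (m &&& (m - 1))) := by omega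
    rw [e1, e2, e3]
    simp only [Nat.testBit_xor, Nat.testBit_and]

theorem low_odd (m : Nat) : low (2 * m + 1) = 1 := by
  apply Nat.eq_of_testBit_eq
  intro i
  change ((2 * m + 1) ^^^ ((2 * m + 1) &&& (2 * m + 1 - 1))).testBit i = Nat.testBit 1 i
  have h1 : 2 * m + 1 - 1 = 2 * m := by omega
  rw [h1]
  cases i with
  | zero => simp only [Nat.testBit_xor, Nat.testBit_and]; simp
  | succ i =>
    simp only [Nat.testBit_xor, Nat.testBit_and]
    simp only [Nat.testBit_succ]
    have e1 : (2 * m + 1) / 2 = m := by omega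
    have e2 : 2 * m / 2 = m := by omega
    rw [e1, e2]
    simp

theorem low_spec (R : Nat) (hR : R ≠ 0) : ∃ v, low R = 2 ^ v ∧ R.testBit v = true := by
  induction R using Nat.strong_induction_on with
  | _ R ih =>
    rcases Nat.even_or_odd' R with ⟨m, rfl | rfl⟩
    · obtain ⟨v, h1, h2⟩ := ih m (by omega) (by omega)
      refine ⟨v + 1, ?_, ?_⟩
      · rw [low_double, h1, pow_succ]; ring
      · rw [Nat.testBit_succ]
        have e : 2 * m / 2 = m := by omega
        rw [e]; exact h2
    · exact ⟨0, by rw [low_odd]; rfl, by simp⟩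

theorem low_bit {R a : Nat} (h : (low R).testBit a = true) :
    low R = 2 ^ a ∧ R.testBit a = true := by
  by_cases hR : R = 0
  · subst hR; rw [low_zero] at h; simp at h
  · obtain ⟨v, h1, h2⟩ := low_spec R hR
    rw [h1, Nat.testBit_two_pow] at h
    have : v = a := by simpa using h
    subst this
    exact ⟨h1, h2⟩

theorem row_bit (v j : Nat) :
    (row (2 ^ v)).testBit j = (decide (v ≤ 127 + j) && cub.testBit (127 + j - v)) := by
  change ((cub * 2 ^ v) >>> 127).testBit j = _
  rw [Nat.testBit_shiftRight, Nat.testBit_mul_two_pow]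

/-- Independent sets of the circulant graph. -/
def Ind (s : Finset ℕ) : Prop :=
  ∀ a ∈ s, ∀ b ∈ s, a ≠ b → cub.testBit (127 + b - a) = false

theorem Ind.rowBit {s : Finset ℕ} (hs : Ind s) {a b : ℕ} (ha : a ∈ s) (hb : b ∈ s) (h : a ≠ b) :
    (row (2 ^ a)).testBit b = false := by
  rw [row_bit, hs a ha b hb h, Bool.and_false]

theorem Ind.eq_of_low {s : Finset ℕ} (hs : Ind s) {X Y : ℕ} {a b : ℕ} (ha : a ∈ s) (hb : b ∈ s)
    (hX : (low X).testBit a = true) (hY : (Y &&& row (low X)).testBit b = true) : a = b := by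
  by_contra hne
  rw [(low_bit hX).1, Nat.testBit_and, hs.rowBit ha hb hne, Bool.and_false] at hY
  exact Bool.noConfusion hY

theorem Ind.mono {s t : Finset ℕ} (hs : Ind s) (h : t ⊆ s) : Ind t :=
  fun a ha b hb => hs a (h ha) b (h hb)

theorem step_le {s : Finset ℕ} (hs : Ind s) (Q : ℕ) :
    (s.filter (fun a => Q.testBit a = true)).card ≤
      (s.filter (fun a => (s1 Q (low Q)).testBit a = true)).card + 1 := by
  set R := Q &&& row (low Q) with hR
  set R2 := R &&& row (low R) with hR2
  have e : s1 Q (low Q) = ((Q ^^^ low Q) ^^^ low R) ^^^ low R2 := rfl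
  rw [e]
  let D : ℕ → Prop := fun a =>
    (low Q).testBit a = true ∨ (low R).testBit a = true ∨ (low R2).testBit a = true
  classical
  have hsub : s.filter (fun a => Q.testBit a = true) ⊆
      s.filter (fun a => (((Q ^^^ low Q) ^^^ low R) ^^^ low R2).testBit a = true) ∪ s.filter D := by
    intro a ha
    rw [Finset.mem_filter] at ha
    rw [Finset.mem_union, Finset.mem_filter, Finset.mem_filter]
    by_cases hD : D a
    · exact Or.inr ⟨ha.1, hD⟩
    · refine Or.inl ⟨ha.1, ?_⟩
      simp only [D, not_or, Bool.not_eq_true] at hD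
      simp only [Nat.testBit_xor, ha.2, hD.1, hD.2.1, hD.2.2, Bool.xor_false]
  have hD1 : (s.filter D).card ≤ 1 := by
    rw [Finset.card_le_one]
    have key : ∀ a ∈ s, ∀ b ∈ s, (low R2).testBit b = true →
        ((low Q).testBit a = true ∨ (low R).testBit a = true) → a = b := by
      intro a ha b hb hb2 h
      have h2 : R2.testBit b = true := (low_bit hb2).2
      have h1 : R.testBit b = true := by
        rw [hR2, Nat.testBit_and, Bool.and_eq_true] at h2; exact h2.1
      rcases h with h | h
      · exact hs.eq_of_low ha hb h h1
      · exact hs.eq_of_low ha hb h h2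
    have key1 : ∀ a ∈ s, ∀ b ∈ s, (low Q).testBit a = true → (low R).testBit b = true → a = b := by
      intro a ha b hb h h'
      exact hs.eq_of_low ha hb h (low_bit h').2
    have same : ∀ X a b : ℕ, (low X).testBit a = true → (low X).testBit b = true → a = b := by
      intro X a b h h'
      have := (low_bit h).1.symm.trans (low_bit h').1
      exact Nat.pow_right_injective (le_refl 2) this
    intro a ha b hb
    rw [Finset.mem_filter] at ha hb
    obtain ⟨ha, hDa⟩ := ha
    obtain ⟨hb, hDb⟩ := hb
    rcases hDa with h | h | h <;> rcases hDb with h' | h' | h'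
    · exact same _ _ _ h h'
    · exact key1 a ha b hb h h'
    · exact key a ha b hb h' (Or.inl h)
    · exact (key1 b hb a ha h' h).symm
    · exact same _ _ _ h h'
    · exact key a ha b hb h' (Or.inr h)
    · exact (key b hb a ha h (Or.inl h')).symm
    · exact (key b hb a ha h (Or.inr h')).symm
    · exact same _ _ _ h h'
  calc _ ≤ _ := Finset.card_le_card hsub
    _ ≤ _ := Finset.card_union_le _ _
    _ ≤ _ := by omega

theorem cover_le {s : Finset ℕ} (hs : Ind s) (n : ℕ) : ∀ Q : ℕ,
    (s.filter (fun a => Q.testBit a = true)).card ≤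
      (s.filter (fun a => (cover n Q).testBit a = true)).card + n := by
  induction n with
  | zero => intro Q; exact le_refl _
  | succ n ih =>
    intro Q
    rcases Nat.eq_zero_or_pos Q with rfl | hQ
    · simp
    · have e : cover (n + 1) Q = cover n (s1 Q (low Q)) := by
        obtain ⟨q, rfl⟩ : ∃ q, Q = q + 1 := ⟨Q - 1, by omega⟩
        rfl
      rw [e]
      have h1 := step_le hs Q
      have h2 := ih (s1 Q (low Q))
      omega

theorem both_eq {a b : Bool} (h : both a b = true) : a = true ∧ b = true := by
  cases a
  · exact Bool.noConfusion h
  · exact ⟨rfl, h⟩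

theorem imp_eq {a b : Bool} (h : imp a b = true) (ha : a = true) : b = true := by
  subst ha; exact h

theorem loop_sound {f : ℕ → Bool} {k : ℕ}
    (hf : ∀ P (s : Finset ℕ), Ind s → (∀ a ∈ s, P.testBit a = true) → f P = true → s.card < k)
    (fuel : ℕ) : ∀ (Q P : ℕ) (s : Finset ℕ), Ind s → (∀ a ∈ s, P.testBit a = true) →
      (∃ a ∈ s, Q.testBit a = true) → loop f fuel Q P = true → s.card < k + 1 := by
  induction fuel with
  | zero => intro Q P s _ _ _ h; exact Bool.noConfusion h
  | succ n ih =>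
    intro Q P s hs hP hQ h
    obtain ⟨a, ha, haQ⟩ := hQ
    have hQ0 : Q ≠ 0 := by rintro rfl; simp at haQ
    have e : loop f (n + 1) Q P =
        both (f (cut (P ^^^ low Q) (low Q))) (loop f n (Q ^^^ low Q) (P ^^^ low Q)) := by
      obtain ⟨q, rfl⟩ : ∃ q, Q = q + 1 := ⟨Q - 1, by omega⟩
      rfl
    rw [e] at h
    obtain ⟨h1, h2⟩ := both_eq h
    obtain ⟨v, hv, _⟩ := low_spec Q hQ0
    rw [hv] at h1 h2
    by_cases hvs : v ∈ s
    · have := hf _ (s.erase v) (hs.mono (Finset.erase_subset _ _)) ?_ h1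
      · rw [Finset.card_erase_of_mem hvs] at this
        have := Finset.card_pos.mpr ⟨v, hvs⟩
        omega
      · intro b hb
        rw [Finset.mem_erase] at hb
        change ((P ^^^ 2 ^ v) ^^^ ((P ^^^ 2 ^ v) &&& row (2 ^ v))).testBit b = true
        simp only [Nat.testBit_xor, Nat.testBit_and, hs.rowBit hvs hb.2 (Ne.symm hb.1), hP b hb.2,
          Nat.testBit_two_pow_of_ne (Ne.symm hb.1)]
        rfl
    · have hne : ∀ b ∈ s, v ≠ b := fun b hb hvb => hvs (hvb ▸ hb)
      refine ih _ _ s hs ?_ ⟨a, ha, ?_⟩ h2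
      · intro b hb
        rw [Nat.testBit_xor, hP b hb, Nat.testBit_two_pow_of_ne (hne b hb)]; rfl
      · rw [Nat.testBit_xor, haQ, Nat.testBit_two_pow_of_ne (hne a ha)]; rfl

theorem search_sound (k : ℕ) : ∀ (P : ℕ) (s : Finset ℕ), Ind s → (∀ a ∈ s, P.testBit a = true) →
    search k P = true → s.card < k := by
  induction k with
  | zero => intro P s _ _ h; exact Bool.noConfusion h
  | succ k ih =>
    intro P s hs hP h
    have h' : loop (search k) 127 (cover k P) P = true := h
    by_contra hlt
    have hc := cover_le hs k P
    rw [Finset.filter_true_of_mem hP] at hc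
    have hpos : 0 < (s.filter (fun a => (cover k P).testBit a = true)).card := by omega
    obtain ⟨a, ha⟩ := Finset.card_pos.mp hpos
    rw [Finset.mem_filter] at ha
    exact hlt (loop_sound ih 127 _ P s hs hP ⟨a, ha⟩ h')

/-- The circulant graph on 127 vertices has no independent set of size 12. -/
theorem base_bound (s : Finset ℕ) (hs : Ind s) (hb : ∀ a ∈ s, a < 127) : s.card < 12 := by
  rcases s.eq_empty_or_nonempty with rfl | ⟨x, hx⟩
  · simp
  have hx127 := hb x hx
  let f : ℕ → ℕ := fun y => (y + 127 - x) % 127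
  have hinj : Set.InjOn f s := by
    intro a ha b hb' hab
    have h1 := hb a ha
    have h2 := hb b hb'
    simp only [f] at hab
    omega
  have hcard : (s.image f).card = s.card := Finset.card_image_of_injOn hinj
  have hind : Ind (s.image f) := by
    intro a ha b hb' hab
    rw [Finset.mem_image] at ha hb'
    obtain ⟨a, ha, rfl⟩ := ha
    obtain ⟨b, hb', rfl⟩ := hb'
    have h1 := hb a ha
    have h2 := hb b hb'
    have hne : a ≠ b := fun h => hab (by rw [h])
    have := hs a ha b hb' hne
    have l1 : f a < 127 := Nat.mod_lt _ (by norm_num)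
    have l2 : f b < 127 := Nat.mod_lt _ (by norm_num)
    rw [run_per _ (by omega)] at this ⊢
    rw [← this]
    congr 1
    simp only [f]
    omega
  have h0 : 0 ∈ s.image f := Finset.mem_image.mpr ⟨x, hx, by simp [f]⟩
  have key := search_sound 11 _ ((s.image f).erase 0) (hind.mono (Finset.erase_subset _ _)) ?_ run_base
  · rw [Finset.card_erase_of_mem h0, hcard] at key
    omega
  · intro b hb'
    rw [Finset.mem_erase] at hb'
    have hlt : b < 127 := by
      obtain ⟨y, _, rfl⟩ := Finset.mem_image.mp hb'.2
      exact Nat.mod_lt _ (by norm_num)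
    have hr := hind.rowBit h0 hb'.2 (Ne.symm hb'.1)
    have hbit : ∀ b < 127, b ≠ 0 → Nat.testBit (2 ^ 127 - 2) b = true := by decide
    change ((2 ^ 127 - 2) ^^^ ((2 ^ 127 - 2) &&& row (2 ^ 0))).testBit b = true
    rw [Nat.testBit_xor, Nat.testBit_and, hr, hbit b hlt hb'.1]
    rfl

theorem allB_spec {f : ℕ → Bool} {n : ℕ} (h : allB f n = true) : ∀ i < n, f i = true := by
  induction n with
  | zero => intro i hi; omega
  | succ n ih =>
    have h' : both (f n) (allB f n) = true := h
    obtain ⟨h1, h2⟩ := both_eq h'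
    intro i hi
    rcases Nat.lt_succ_iff_lt_or_eq.mp hi with hi | rfl
    · exact ih h2 i hi
    · exact h1

theorem beq_bit (x i : ℕ) : Nat.beq (Nat.land 1 (Nat.shiftRight x i)) 1 = x.testBit i := by
  change Nat.beq (1 &&& (x >>> i)) 1 = (1 &&& (x >>> i) != 0)
  rw [Nat.one_and_eq_mod_two]
  rcases Nat.mod_two_eq_zero_or_one (x >>> i) with h | h <;> rw [h] <;> rfl

theorem bit_eq (a b : ℕ) : bit a b = (trow a).testBit b := beq_bit _ _

theorem beq_bit0 {x i : ℕ} (h : Nat.beq (Nat.land 1 (Nat.shiftRight x i)) 0 = true) :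
    x.testBit i = false := by
  rw [← beq_bit, Nat.eq_of_beq_eq_true h]; rfl

theorem cub_of_bit {a b : ℕ} (ha : a < 127) (hb : b < a) (h : bit a b = false) :
    cub.testBit (127 + b - a) = false ∧ cub.testBit (127 + a - b) = false := by
  have h1 := imp_eq (allB_spec (allB_spec run_E a ha) b hb) (by rw [h]; rfl)
  rw [Bool.and_eq_true] at h1
  exact ⟨beq_bit0 h1.1, beq_bit0 h1.2⟩

/-- Independent sets of the graph on 137 vertices. -/
def IndG (s : Finset ℕ) : Prop := ∀ a ∈ s, ∀ b ∈ s, b < a → bit a b = false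

theorem IndG.mono {s t : Finset ℕ} (hs : IndG s) (h : t ⊆ s) : IndG t :=
  fun a ha b hb => hs a (h ha) b (h hb)

theorem IndG.ind {s : Finset ℕ} (hs : IndG s) (hb : ∀ a ∈ s, a < 127) : Ind s := by
  intro a ha b hb' hab
  rcases Nat.lt_or_gt_of_ne hab with h | h
  · exact (cub_of_bit (hb b hb') h (hs b hb' a ha h)).2
  · exact (cub_of_bit (hb a ha) h (hs a ha b hb' h)).1

theorem go_sound (n : ℕ) : ∀ (need P : ℕ) (s : Finset ℕ), IndG s →
    (∀ a ∈ s, P.testBit a = true) → (∀ a ∈ s, a < 127 + n) → go n need P = true →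
    s.card < need := by
  induction n with
  | zero =>
    intro need P s hs hP hb h
    have hi := hs.ind hb
    have h' : imp (Nat.ble need 11) (search need (P &&& (2 ^ 127 - 1))) = true := h
    by_cases hn : need ≤ 11
    · refine search_sound need _ s hi ?_ (imp_eq h' (Nat.ble_eq_true_of_le hn))
      intro a ha
      rw [Nat.testBit_and, hP a ha, Nat.testBit_two_pow_sub_one]
      simpa using hb a ha
    · have := base_bound s hi hb
      omega
  | succ n ih =>
    intro need P s hs hP hb h
    have h' : both (go n need P)
      (imp (Nat.beq (Nat.land 1 (Nat.shiftRight P (Nat.add 127 n))) 1)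
        (go n (need - 1) (take P (127 + n)))) = true := h
    obtain ⟨h1, h2⟩ := both_eq h'
    by_cases hu : 127 + n ∈ s
    · have h3 := imp_eq h2 ((beq_bit _ _).trans (hP _ hu))
      have := ih _ _ (s.erase (127 + n)) (hs.mono (Finset.erase_subset _ _)) ?_ ?_ h3
      · rw [Finset.card_erase_of_mem hu] at this
        have := Finset.card_pos.mpr ⟨_, hu⟩
        omega
      · intro a ha
        rw [Finset.mem_erase] at ha
        have hlt : a < 127 + n := by
          have := hb a ha.2
          have := ha.1
          omega
        have hz := hs _ hu a ha.2 hlt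
        rw [bit_eq] at hz
        change (P ^^^ (P &&& trow (127 + n))).testBit a = true
        rw [Nat.testBit_xor, Nat.testBit_and, hz, hP a ha.2]
        rfl
      · intro a ha
        rw [Finset.mem_erase] at ha
        have := hb a ha.2
        have := ha.1
        omega
    · refine ih _ _ s hs hP ?_ h1
      intro a ha
      have := hb a ha
      have : a ≠ 127 + n := fun h => hu (h ▸ ha)
      omega

theorem no_K4 {a b c d : ℕ} (ha : a < 137) (hb : b < a) (hc : c < b) (hd : d < c)
    (hab : bit a b = true) (hac : bit a c = true) (had : bit a d = true) (hbc : bit b c = true)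
    (hbd : bit b d = true) (hcd : bit c d = true) : False := by
  have h1 : chkC a b = true := imp_eq (allB_spec (allB_spec run_K4 a ha) b hb) hab
  have h2 : chkD a b c = true :=
    imp_eq (allB_spec h1 c hc) (by rw [hac, hbc]; rfl)
  have h3 : ((trow a &&& trow b) &&& trow c) % 2 ^ c = 0 := Nat.eq_of_beq_eq_true h2
  have h4 : (((trow a &&& trow b) &&& trow c) % 2 ^ c).testBit d = true := by
    rw [bit_eq] at had hbd hcd
    rw [Nat.testBit_mod_two_pow, Nat.testBit_and, Nat.testBit_and, had, hbd, hcd]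
    simpa using hd
  rw [h3] at h4
  simp at h4

/-- The graph: the cubic residue graph on 127 vertices extended by ten vertices. -/
def graph : SimpleGraph (Fin 137) where
  Adj a b := (b.val < a.val ∧ bit a b = true) ∨ (a.val < b.val ∧ bit b a = true)
  symm := ⟨fun _ _ h => h.symm⟩
  loopless := ⟨fun a h => by rcases h with h | h <;> exact lt_irrefl _ h.1⟩

theorem graph_bit {a b : Fin 137} (h : graph.Adj a b) (hlt : b < a) : bit a b = true := by
  rcases h with h | h
  · exact h.2
  · exact absurd h.1 (by have : b.val < a.val := hlt; omega)

theorem graph_K4 : graph.CliqueFree 4 := by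
  intro s hs
  have hc := hs.card_eq
  let e := s.orderEmbOfFin hc
  have hadj : ∀ i j : Fin 4, i < j → bit (e j) (e i) = true := by
    intro i j hij
    have hlt : e i < e j := e.strictMono hij
    refine graph_bit (hs.isClique ?_ ?_ hlt.ne') hlt
    · exact s.orderEmbOfFin_mem hc j
    · exact s.orderEmbOfFin_mem hc i
  have hlt : ∀ i j : Fin 4, i < j → (e i).val < (e j).val := fun i j hij => e.strictMono hij
  exact no_K4 (a := e 3) (b := e 2) (c := e 1) (d := e 0) (e 3).isLt
    (hlt _ _ (by decide)) (hlt _ _ (by decide)) (hlt _ _ (by decide))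
    (hadj _ _ (by decide)) (hadj _ _ (by decide)) (hadj _ _ (by decide))
    (hadj _ _ (by decide)) (hadj _ _ (by decide)) (hadj _ _ (by decide))

theorem graph_K13 : graphᶜ.CliqueFree 13 := by
  intro s hs
  have hc := hs.card_eq
  have hcard : (s.image Fin.val).card = 13 := by
    rw [Finset.card_image_of_injective _ Fin.val_injective, hc]
  have key := go_sound 10 13 _ (s.image Fin.val) ?_ ?_ ?_ run_go
  · omega
  · intro a ha b hb hlt
    rw [Finset.mem_image] at ha hb
    obtain ⟨a, ha, rfl⟩ := ha
    obtain ⟨b, hb, rfl⟩ := hb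
    have hne : a ≠ b := by rintro rfl; exact lt_irrefl _ hlt
    have h := hs.isClique ha hb hne
    rw [SimpleGraph.compl_adj] at h
    by_contra hbit
    exact h.2 (Or.inl ⟨hlt, by simpa using hbit⟩)
  · intro a ha
    obtain ⟨a, _, rfl⟩ := Finset.mem_image.mp ha
    rw [Nat.testBit_two_pow_sub_one]
    simp
  · intro a ha
    obtain ⟨a, _, rfl⟩ := Finset.mem_image.mp ha
    exact a.isLt

end R413

theorem ramsey_lower_bound_R_4_13 :
    ∃ G : SimpleGraph (Fin 137), G.CliqueFree 4 ∧ Gᶜ.CliqueFree 13 := by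
  exact ⟨R413.graph, R413.graph_K4, R413.graph_K13⟩
end

section
/- R(5,11) ≥ 174; that is, there exists a 2-coloring of the edges of the complete graph K_173 containing no monochromatic K_5 in color 1 and no monochromatic K_11 in color 2. -/
/-! Overview.
The graph is the restriction to 173 consecutive vertices of a circulant graph on `ZMod 182`
whose connection set is invariant under multiplication by `-1` and by `53` (of order 3).
Sets of residues are bit masks (natural numbers).
-/

/-- The multiplier group. -/
def mults : List ℕ := [1, 53, 79, 181, 129, 103]

/-- Clique search: `true` certifies that there is no `k`-clique inside the set `P`,
where `x < y` are adjacent when `y - x` (equivalently `x - y`) lies in `M` mod 182. -/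
noncomputable def noClique (M : ℕ) (fuel : ℕ) : ℕ → ℕ → Bool :=
  Nat.rec (motive := fun _ => ℕ → ℕ → Bool) (fun _ _ => false)
    (fun _ ih k P =>
      Nat.rec (motive := fun _ => Bool) false
        (fun k' _ =>
          Nat.rec (motive := fun _ => Bool) true
            (fun p _ =>
              Bool.rec (motive := fun _ => Bool) false
                (ih (Nat.succ k')
                  (Nat.div (Nat.land (Nat.succ p) p) (Nat.sub (Nat.succ p) (Nat.land (Nat.succ p) p))))
                (ih k' (Nat.land M
                  (Nat.div (Nat.land (Nat.succ p) p) (Nat.sub (Nat.succ p) (Nat.land (Nat.succ p) p))))))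
            P) k) fuel

theorem noClique_step (M f k p : ℕ) (h : noClique M (f + 1) (k + 1) (p + 1) = true) :
    noClique M f k (M &&& (((p + 1) &&& p) / ((p + 1) - ((p + 1) &&& p)))) = true
    ∧ noClique M f (k + 1) (((p + 1) &&& p) / ((p + 1) - ((p + 1) &&& p))) = true := by
  change Bool.rec (motive := fun _ => Bool) false
    (noClique M f (k + 1) (((p + 1) &&& p) / ((p + 1) - ((p + 1) &&& p))))
    (noClique M f k (M &&& (((p + 1) &&& p) / ((p + 1) - ((p + 1) &&& p)))))
    = true at h
  generalize noClique M f k _ = a at h ⊢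
  generalize noClique M f (k + 1) _ = b at h ⊢
  cases a
  · exact absurd h (by simp)
  · exact ⟨rfl, h⟩

/-- Clearing the lowest set bit. -/
theorem low_bit (p : ℕ) : ∃ v : ℕ, (p + 1) - ((p + 1) &&& p) = 2 ^ v ∧
    ∀ x, (p + 1).testBit x = true → x = v ∨ (v < x ∧ ((p + 1) &&& p).testBit x = true) := by
  obtain ⟨v, q, ⟨m, rfl⟩, hq⟩ := Nat.exists_eq_two_pow_mul_odd (n := p + 1) (by omega)
  have hpos : 0 < 2 ^ v := by positivity
  have hs : 2 ^ (v + 1) = 2 * 2 ^ v := by ring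
  have hq1 : p + 1 = 2 ^ (v + 1) * m + 2 ^ v := by rw [hq]; ring
  have hq2 : p = 2 ^ (v + 1) * m + (2 ^ v - 1) := by omega
  have e1 : ∀ x, (p + 1).testBit x
      = if x < v + 1 then (2 ^ v).testBit x else m.testBit (x - (v + 1)) := by
    intro x; rw [hq1, Nat.testBit_two_pow_mul_add _ (by omega)]
  have e2 : ∀ x, p.testBit x
      = if x < v + 1 then (2 ^ v - 1).testBit x else m.testBit (x - (v + 1)) := by
    intro x; conv_lhs => rw [hq2]
    rw [Nat.testBit_two_pow_mul_add _ (by omega)]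
  have hand : (p + 1) &&& p = 2 ^ (v + 1) * m := by
    apply Nat.eq_of_testBit_eq
    intro x
    rw [Nat.testBit_and, e1, e2, Nat.testBit_two_pow_mul]
    by_cases hx : x < v + 1
    · rw [if_pos hx, if_pos hx, Nat.testBit_two_pow, Nat.testBit_two_pow_sub_one]
      have h3 : ¬ (v + 1 ≤ x) := by omega
      by_cases h4 : v = x
      · simp [h4]
      · simp [h4, h3]
    · have h3 : v + 1 ≤ x := by omega
      rw [if_neg hx, if_neg hx]
      simp [h3]
  refine ⟨v, by rw [hand]; omega, ?_⟩
  intro x hx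
  rw [e1] at hx
  by_cases hxv : x < v + 1
  · rw [if_pos hxv, Nat.testBit_two_pow] at hx
    left
    simpa using (of_decide_eq_true hx).symm
  · rw [if_neg hxv] at hx
    right
    refine ⟨by omega, ?_⟩
    have h3 : v + 1 ≤ x := by omega
    rw [hand, Nat.testBit_two_pow_mul]
    simp [h3, hx]

theorem noClique_sound (M : ℕ) : ∀ (f k P : ℕ), noClique M f k P = true →
    ∀ (c : ℕ) (T : Finset ℕ), T.card = k → (∀ x ∈ T, c ≤ x ∧ P.testBit (x - c) = true) →
      (∀ x ∈ T, ∀ y ∈ T, x < y → M.testBit (y - x) = true) → False := by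
  intro f
  induction f with
  | zero => intro k P h; exact absurd h (by simp [noClique])
  | succ f ih =>
    intro k P h c T hc hP hM
    cases k with
    | zero => exact absurd h (by simp [noClique])
    | succ k =>
      cases P with
      | zero =>
        have hne : T.Nonempty := Finset.card_pos.mp (by omega)
        obtain ⟨x, hx⟩ := hne
        simpa using (hP x hx).2
      | succ p =>
        obtain ⟨h1, h2⟩ := noClique_step M f k p h
        obtain ⟨v, hv, hb⟩ := low_bit p
        rw [hv] at h1 h2
        have hx' : ∀ x ∈ T, x ≠ c + v → c + v < x ∧
            (((p + 1) &&& p) / 2 ^ v).testBit (x - (c + v)) = true := by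
          intro x hx hxv
          obtain ⟨h5, h6⟩ := hP x hx
          rcases hb _ h6 with h3 | ⟨h3, h4⟩
          · omega
          · refine ⟨by omega, ?_⟩
            rw [Nat.testBit_div_two_pow, show x - (c + v) + v = x - c by omega]
            exact h4
        by_cases hvT : c + v ∈ T
        · refine ih _ _ h1 (c + v) (T.erase (c + v)) ?_ ?_ ?_
          · rw [Finset.card_erase_of_mem hvT]; omega
          · intro x hx
            rw [Finset.mem_erase] at hx
            obtain ⟨h3, h4⟩ := hx' x hx.2 hx.1
            refine ⟨h3.le, ?_⟩
            rw [Nat.testBit_and, h4, hM _ hvT x hx.2 h3]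
            rfl
          · intro x hx y hy
            exact hM x (Finset.mem_of_mem_erase hx) y (Finset.mem_of_mem_erase hy)
        · refine ih _ _ h2 (c + v) T hc (fun x hx => ?_) hM
          obtain ⟨h3, h4⟩ := hx' x hx (fun e => hvT (e ▸ hx))
          exact ⟨h3.le, h4⟩

/-- One elimination step: `M'` is `M` with the orbit of `r` removed. -/
def StepOK (M r M' : ℕ) : Prop :=
  r < 182 ∧ ∀ d : Fin 182, M.testBit d.val = true →
    (∀ u ∈ mults, M.testBit (u * d.val % 182) = true) ∧
    (M'.testBit d.val = true ∨ ∃ u ∈ mults, u * d.val % 182 = r)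

instance (M r M' : ℕ) : Decidable (StepOK M r M') := by
  unfold StepOK; infer_instance

/-- Common neighbourhood of `0` and `r`. -/
def common (M r : ℕ) : ℕ := M &&& ((M <<< r) ||| (M >>> (182 - r)))

/-- A chain of elimination steps ending in the empty set. -/
def Chain (s : ℕ) : ℕ → List (ℕ × ℕ) → Prop
  | M, [] => M = 0
  | M, (r, M') :: l => StepOK M r M' ∧ noClique M 200 s (common M r) = true ∧ Chain s M' l

noncomputable instance decChain (s : ℕ) : ∀ (M : ℕ) (l : List (ℕ × ℕ)), Decidable (Chain s M l)
  | M, [] => inferInstanceAs (Decidable (M = 0))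
  | M, (r, M') :: l =>
    have := decChain s M' l
    inferInstanceAs (Decidable (StepOK M r M' ∧ noClique M 200 s (common M r) = true ∧ Chain s M' l))

def IsCl (M : ℕ) (S : Finset (ZMod 182)) : Prop :=
  ∀ x ∈ S, ∀ y ∈ S, x ≠ y → M.testBit (x - y).val = true

theorem mults_unit : ∀ u ∈ mults, IsUnit (u : ZMod 182) := by
  have h : ∀ u ∈ mults, Nat.Coprime u 182 := by decide
  intro u hu
  exact (ZMod.isUnit_iff_coprime u 182).mpr (h u hu)

theorem val_cast_mul (u : ℕ) (d : ZMod 182) : ((u : ZMod 182) * d).val = u * d.val % 182 := by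
  rw [ZMod.val_mul, ZMod.val_natCast, Nat.mod_mul_mod]

theorem no_pair (M r s : ℕ) (hr : r < 182)
    (hs : noClique M 200 s (common M r) = true) (T : Finset (ZMod 182)) (hT : IsCl M T)
    (hc : T.card = s + 2) (h0 : (0 : ZMod 182) ∈ T) (hrT : (r : ZMod 182) ∈ T)
    (hr0 : (r : ZMod 182) ≠ 0) : False := by
  have hrv : (r : ZMod 182).val = r := by rw [ZMod.val_natCast, Nat.mod_eq_of_lt hr]
  refine noClique_sound M 200 s _ hs 0 (((T.erase 0).erase (r : ZMod 182)).image ZMod.val) ?_ ?_ ?_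
  · rw [Finset.card_image_of_injective _ (ZMod.val_injective 182),
      Finset.card_erase_of_mem (Finset.mem_erase.mpr ⟨hr0, hrT⟩), Finset.card_erase_of_mem h0]
    omega
  · intro x hx
    rw [Finset.mem_image] at hx
    obtain ⟨z, hz, rfl⟩ := hx
    simp only [Finset.mem_erase] at hz
    obtain ⟨hzr, hz0, hzT⟩ := hz
    have h1 := hT z hzT 0 h0 hz0
    rw [sub_zero] at h1
    have h2 := hT z hzT _ hrT hzr
    refine ⟨Nat.zero_le _, ?_⟩
    rw [Nat.sub_zero]
    unfold common
    rw [Nat.testBit_and, h1, Nat.testBit_or, Nat.testBit_shiftLeft, Nat.testBit_shiftRight]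
    have hzl := ZMod.val_lt z
    by_cases hle : r ≤ z.val
    · rw [ZMod.val_sub (by rw [hrv]; exact hle), hrv] at h2
      simp [hle, h2]
    · have h3 : (z - (r : ZMod 182)).val = 182 - r + z.val := by
        have : z - (r : ZMod 182) = ((182 - r + z.val : ℕ) : ZMod 182) := by
          rw [Nat.cast_add, Nat.cast_sub hr.le, ZMod.natCast_zmod_val]
          have : ((182 : ℕ) : ZMod 182) = 0 := ZMod.natCast_self 182
          rw [this]; ring
        rw [this, ZMod.val_natCast, Nat.mod_eq_of_lt (by omega)]
      rw [h3] at h2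
      simp [h2]
  · intro x hx y hy hxy
    rw [Finset.mem_image] at hx hy
    obtain ⟨z, hz, rfl⟩ := hx
    obtain ⟨w, hw, rfl⟩ := hy
    simp only [Finset.mem_erase] at hz hw
    have h2 := hT w hw.2.2 z hz.2.2 (fun e => by rw [e] at hxy; omega)
    rwa [ZMod.val_sub hxy.le] at h2

theorem step_sound (M r M' s : ℕ) (h : StepOK M r M')
    (hs : noClique M 200 s (common M r) = true) (S : Finset (ZMod 182)) (hS : IsCl M S)
    (hc : S.card = s + 2) : IsCl M' S := by
  obtain ⟨hr, h⟩ := h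
  intro x hx y hy hxy
  have hb := hS x hx y hy hxy
  obtain ⟨-, h2⟩ := h ⟨(x - y).val, ZMod.val_lt _⟩ hb
  rcases h2 with h2 | ⟨u, hu, hur⟩
  · exact h2
  exfalso
  have huu := mults_unit u hu
  have hur' : (u : ZMod 182) * (x - y) = (r : ZMod 182) := by
    apply ZMod.val_injective 182
    rw [val_cast_mul, ZMod.val_natCast, Nat.mod_eq_of_lt hr]
    exact hur
  have hinj : Function.Injective (fun z : ZMod 182 => (u : ZMod 182) * (z - y)) := by
    intro a b hab
    have := huu.mul_left_cancel hab
    exact sub_left_injective this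
  refine no_pair M r s hr hs (S.image (fun z : ZMod 182 => (u : ZMod 182) * (z - y))) ?_ ?_ ?_ ?_ ?_
  · intro a ha b hb' hab
    rw [Finset.mem_image] at ha hb'
    obtain ⟨a, ha, rfl⟩ := ha
    obtain ⟨b, hb', rfl⟩ := hb'
    have hne : a ≠ b := fun e => hab (by rw [e])
    have h1 := (h ⟨(a - b).val, ZMod.val_lt _⟩ (hS a ha b hb' hne)).1 u hu
    have h3 : (u : ZMod 182) * (a - y) - u * (b - y) = u * (a - b) := by ring
    simp only [h3, val_cast_mul]
    exact h1
  · rw [Finset.card_image_of_injective _ hinj, hc]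
  · exact Finset.mem_image.mpr ⟨y, hy, by simp⟩
  · exact Finset.mem_image.mpr ⟨x, hx, hur'⟩
  · rw [← hur']
    intro h0
    have := huu.mul_left_cancel (h0.trans (mul_zero _).symm)
    exact hxy (sub_eq_zero.mp this)

theorem chain_sound (s : ℕ) : ∀ (l : List (ℕ × ℕ)) (M : ℕ), Chain s M l →
    ∀ S : Finset (ZMod 182), IsCl M S → S.card = s + 2 → False
  | [], M, h, S, hS, hc => by
    have hM : M = 0 := h
    obtain ⟨x, hx, y, hy, hxy⟩ := Finset.one_lt_card.mp (show 1 < S.card by omega)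
    have := hS x hx y hy hxy
    simp [hM] at this
  | (r, M') :: l, M, h, S, hS, hc =>
    chain_sound s l M' h.2.2 S (step_sound M r M' s h.1 h.2.1 S hS hc) hc

/-- Connection set of the first colour. -/
def edgeMask : ℕ := 2706976898455478066966101654095856790287608566305808668

/-- Connection set of the second colour. -/
def coMask : ℕ := 3423005265008077366467286454505379944187347922428600034

theorem edge_chain : Chain 3 2706976898455478066966101654095856790287608566305808668
  [(35, 2706976898277072105377856668963571044106421639898226972),
   (4, 2323853007351587341892947447881188214428599204605354252),
   (14, 2323478862932430630745887304564012845975567285874336012),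
   (49, 2323478862932419741710145834533182017987566519338148108),
   (91, 2323478862932419741710145832057301939416805969539899660),
   (2, 790982956691121550625988124347294412181890230027821320),
   (18, 790959572307763883859079854138812963693174210996740360),
   (63, 790959572307763883194465856246355018017898644001792264),
   (3, 24711071124000618422649780359552336343686742032261376),
   (42, 24711071122606821847741616413206353951641821391626496),
   (8, 765828296577303118980381668785513469775416154136576),
   (47, 765828296533704440069599320827970267410243956252672),
   (13, 17539447069909380530501642594853218557646031290368),
   (19, 5847433797037585321193175629220399016828195569664),
   (20, 40564819358419068299723149410304),
   (77, 0)] := by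
  decide +kernel

theorem co_chain : Chain 9 3423005265008077366467286454505379944187347922428600034
  [(7, 3375114779356018339643588109906932782199262324860362338),
   (70, 3375114779356018339638395813048396773979111111119838818),
   (9, 3363095389890608994028704115267067816872589370522180706),
   (29, 3363095378472627452380860272220294760883341491995516002),
   (50, 3363095378472621667580617545662806044758654237532068962),
   (40, 3363095378467046480865601141194635812674330972758580322),
   (33, 3363095377753422623876201085956896069145159478443875426),
   (28, 3363095354917459540580842989024320557953237296051493986),
   (12, 3361598777218531950794071786424383169441559610247973986),
   (43, 3361598777217835049848161673112554668089232091949141090),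
   (56, 3361598777217834964777569942877938802173522639969160290),
   (22, 3361597315716197633874325952983992838189928336028961890),
   (1, 296606233984419236592887915601041255449208740657597536),
   (25, 296606005624785681380371578767578436530875665290988640),
   (84, 296606005624785681380371261835585566359691224319888480),
   (6, 200825034320580515445744738177406189210331634049584160),
   (11, 197831878919937742722386017464239840256696179539149856),
   (15, 197644806710359387107317560414883053502251323220886560),
   (36, 197644806621156406292425860298074936362201176697013280),
   (10, 191564959809859848823470535609059321484939418610434080),
   (5, 3014347128356116756761263727213961988971675254784),
   (21, 91343853694310920353894061781395949659808071680),
   (26, 0)] := by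
  decide +kernel

theorem edge_symm : ∀ d : Fin 182, edgeMask.testBit d.val = true →
    edgeMask.testBit ((182 - d.val) % 182) = true := by
  decide +kernel

theorem mask_cover : ∀ d : Fin 182, d.val ≠ 0 → edgeMask.testBit d.val = false →
    coMask.testBit d.val = true := by
  decide +kernel

theorem edge_neg (d : ZMod 182) (h : edgeMask.testBit d.val = true) :
    edgeMask.testBit (-d).val = true := by
  rw [ZMod.neg_val']
  exact edge_symm ⟨d.val, ZMod.val_lt d⟩ h

/-- The inclusion of the vertex set in the cyclic group. -/
def vtx (x : Fin 173) : ZMod 182 := (x.val : ZMod 182)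

theorem vtx_inj : Function.Injective vtx := by
  intro x y h
  have h2 := congrArg ZMod.val h
  unfold vtx at h2
  rw [ZMod.val_natCast, ZMod.val_natCast, Nat.mod_eq_of_lt (by omega),
    Nat.mod_eq_of_lt (by omega)] at h2
  exact Fin.ext h2

theorem isCl_image (M : ℕ) (t : Finset (Fin 173))
    (h : ∀ x ∈ t, ∀ y ∈ t, x ≠ y → M.testBit (vtx x - vtx y).val = true) :
    IsCl M (t.image vtx) := by
  intro a ha b hb hab
  rw [Finset.mem_image] at ha hb
  obtain ⟨x, hx, rfl⟩ := ha
  obtain ⟨y, hy, rfl⟩ := hb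
  exact h x hx y hy (fun e => hab (by rw [e]))

theorem ramsey_lower_bound_R_5_11 :
    ∃ G : SimpleGraph (Fin 173), G.CliqueFree 5 ∧ Gᶜ.CliqueFree 11 := by
  refine ⟨SimpleGraph.fromRel (fun x y => edgeMask.testBit (vtx x - vtx y).val = true), ?_, ?_⟩
  · intro t ht
    refine chain_sound 3 _ _ edge_chain (t.image vtx) (isCl_image _ t ?_) ?_
    · intro x hx y hy hxy
      have := ht.isClique hx hy hxy
      rw [SimpleGraph.fromRel_adj] at this
      rcases this.2 with h | h
      · exact h
      · have h2 := edge_neg _ h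
        rwa [neg_sub] at h2
    · rw [Finset.card_image_of_injective _ vtx_inj, ht.card_eq]
  · intro t ht
    refine chain_sound 9 _ _ co_chain (t.image vtx) (isCl_image _ t ?_) ?_
    · intro x hx y hy hxy
      have := ht.isClique hx hy hxy
      rw [SimpleGraph.compl_adj, SimpleGraph.fromRel_adj] at this
      have h2 : ¬ (edgeMask.testBit (vtx x - vtx y).val = true) :=
        fun e => this.2 ⟨hxy, Or.inl e⟩
      refine mask_cover ⟨(vtx x - vtx y).val, ZMod.val_lt _⟩ ?_ (by simpa using h2)
      intro h0
      exact hxy (vtx_inj (sub_eq_zero.mp ((ZMod.val_eq_zero _).mp h0)))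
    · rw [Finset.card_image_of_injective _ vtx_inj, ht.card_eq]
end

section
/- R(5,13) ≥ 218; that is, there exists a 2-coloring of the edges of the complete graph K_217 containing no monochromatic K_5 in color 1 and no monochromatic K_13 in color 2. -/
/-!
The graph is (an induced subgraph on 217 vertices of) a Cayley graph on the abelian group
`Z_112 × Z_2`, with 224 vertices; the vertex `(x, i)` is coded by the number `2 * x + i`.
The absence of cliques / independent sets is established by a verified branch-and-bound search
on bit masks, evaluated by the kernel.
-/

namespace Ramsey513

/-- Evaluate the number `n` before passing it to `f`. -/
def force {α : Type} (n : ℕ) (f : ℕ → α) : α :=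
  Nat.rec (motive := fun _ => α) (f 0) (fun m _ => f (Nat.succ m)) n

theorem force_eq {α : Type} (n : ℕ) (f : ℕ → α) : force n f = f n := by
  cases n <;> rfl

/-- The row of vertex `v` (only the bits below 224 are relevant). -/
def row (W v : ℕ) : ℕ :=
  Nat.shiftRight W
    (Nat.sub (Nat.add (nat_lit 224) (Nat.mul (nat_lit 449) (Nat.mod v (nat_lit 2)))) v)

def bit (v : ℕ) : ℕ := Nat.shiftLeft (nat_lit 1) v

/-- A table of discrete logarithms to the base 2 modulo 227 (8 bits per entry). -/
def table : ℕ := nat_lit 2075047441393642094760590872405993193481315647770279479850047894518856331875339465410628175271149087945852306585989447880313189651070427978204860647064797022462529374490202439702966886076904456177422017265623127461534026872789271622739130685032581330406397399723175002902946378093310040015606355020026425662529134926088032486699710938118663652720697718410760310242638323128958389193740970832579070379153257750222192796209605376159539131113771218585226533753218243345186252576249247115116572209657261463158449282783045570187578046009667889943085056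

/-- The index of the lowest bit of `r + 1`; no property of this function is needed. -/
def low0 (r : ℕ) : ℕ :=
  Nat.mod (Nat.shiftRight table (Nat.mul (nat_lit 8)
    (Nat.mod (Nat.xor (Nat.succ r) (Nat.land (Nat.succ r) r)) (nat_lit 227)))) (nat_lit 256)

/-- The index of some bit of `r + 1`. Bits above 64 are preferred, which keeps the low-order
words of the masks diverse, hence avoids hash collisions; no property is needed. -/
def low (r : ℕ) : ℕ :=
  Nat.rec (motive := fun _ => ℕ) (low0 r) (fun h _ => Nat.add (nat_lit 64) (low0 h))
    (Nat.shiftRight (Nat.succ r) (nat_lit 64))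

/-- The index of some bit of `R`. -/
def top (R : ℕ) : ℕ := low (R - 1)

/-- A greedy clique inside `R`. -/
def cliq (W : ℕ) (fuel : ℕ) : ℕ → ℕ :=
  Nat.rec (motive := fun _ => ℕ → ℕ) (fun _ => 0)
    (fun _ ih R =>
      Nat.rec (motive := fun _ => ℕ) 0
        (fun r _ => force (low r) fun v =>
          Nat.lor (Nat.land (Nat.succ r) (bit v)) (ih (Nat.land (Nat.succ r) (row W v)))) R) fuel

/-- Remove `j` greedy cliques from `Q`. -/
def cover (W : ℕ) (j : ℕ) : ℕ → ℕ :=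
  Nat.rec (motive := fun _ => ℕ → ℕ) (fun Q => Q)
    (fun _ ih Q => force Q fun Q => ih (Nat.land Q (Nat.xor Q (cliq W 224 Q)))) j

/-- Remove the vertices in `R` from `P`. -/
def rem (P R : ℕ) : ℕ := Nat.xor P (Nat.land P R)

def branch (W : ℕ) (solver : ℕ → Bool) (fuel : ℕ) : ℕ → ℕ → Bool :=
  Nat.rec (motive := fun _ => ℕ → ℕ → Bool) (fun _ _ => false)
    (fun _ ih Q P =>
      Nat.rec (motive := fun _ => Bool) true
        (fun q _ => force (low q) fun v =>
          force (rem P (bit v)) fun P' =>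
            Bool.rec (motive := fun _ => Bool) false (ih (rem (Nat.succ q) (bit v)) P')
              (solver (rem P' (row W v)))) Q) fuel

def solve (W : ℕ) (k : ℕ) : ℕ → Bool :=
  Nat.rec (motive := fun _ => ℕ → Bool) (fun _ => false)
    (fun k ih P => force P fun P => branch W ih 224 (cover W k P) P) k

def Indep (W : ℕ) (S : Finset ℕ) : Prop :=
  ∀ v ∈ S, ∀ u ∈ S, v ≠ u → (row W v).testBit u = false

def Sub (S : Finset ℕ) (P : ℕ) : Prop := ∀ v ∈ S, P.testBit v = true

theorem Indep.mono {W : ℕ} {S T : Finset ℕ} (h : Indep W S) (hT : T ⊆ S) : Indep W T :=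
  fun v hv u hu => h v (hT hv) u (hT hu)

theorem testBit_bit (v u : ℕ) : (bit v).testBit u = decide (v = u) := by
  have : bit v = 2 ^ v := by
    change 1 <<< v = 2 ^ v
    rw [Nat.one_shiftLeft]
  rw [this, Nat.testBit_two_pow]

theorem testBit_rem (P R u : ℕ) : (rem P R).testBit u = (P.testBit u && !R.testBit u) := by
  change (P ^^^ (P &&& R)).testBit u = _
  rw [Nat.testBit_xor, Nat.testBit_and]
  cases P.testBit u <;> cases R.testBit u <;> rfl

theorem cliq_succ (W f R : ℕ) : cliq W (f + 1) R =
    if R = 0 then 0 else (R &&& bit (top R)) ||| cliq W f (R &&& row W (top R)) := by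
  cases R with
  | zero => rfl
  | succ r =>
    rw [if_neg (Nat.succ_ne_zero r)]
    exact force_eq (low r) (fun v =>
      Nat.lor (Nat.land (Nat.succ r) (bit v)) (cliq W f (Nat.land (Nat.succ r) (row W v))))

theorem cover_succ (W j Q : ℕ) : cover W (j + 1) Q =
    cover W j (Q &&& (Q ^^^ cliq W 224 Q)) := by
  exact force_eq Q (fun Q => cover W j (Nat.land Q (Nat.xor Q (cliq W 224 Q))))

theorem branch_succ (W : ℕ) (s : ℕ → Bool) (f Q P : ℕ) : branch W s (f + 1) Q P =
    if Q = 0 then true else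
      (s (rem (rem P (bit (top Q))) (row W (top Q))) &&
        branch W s f (rem Q (bit (top Q))) (rem P (bit (top Q)))) := by
  cases Q with
  | zero => rfl
  | succ q =>
    rw [if_neg (Nat.succ_ne_zero q)]
    refine (force_eq (low q) (fun v => force (rem P (bit v)) fun P' =>
      Bool.rec (motive := fun _ => Bool) false (branch W s f (rem (Nat.succ q) (bit v)) P')
        (s (rem P' (row W v))))).trans ?_
    rw [force_eq, show top (q + 1) = low q from rfl]
    change Bool.rec (motive := fun _ => Bool) false
      (branch W s f (rem (q + 1) (bit (low q))) (rem P (bit (low q))))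
      (s (rem (rem P (bit (low q))) (row W (low q)))) = _
    cases s (rem (rem P (bit (low q))) (row W (low q))) <;> rfl

theorem solve_succ (W k P : ℕ) : solve W (k + 1) P =
    branch W (solve W k) 224 (cover W k P) P := by
  exact force_eq P (fun P => branch W (solve W k) 224 (cover W k P) P)

theorem cliq_sub (W f : ℕ) : ∀ R u, (cliq W f R).testBit u = true → R.testBit u = true := by
  induction f with
  | zero => intro R u h; simp [cliq] at h
  | succ f ih =>
    intro R u h
    rw [cliq_succ] at h
    split_ifs at h with h0
    · simp at h
    · rw [Nat.testBit_or, Nat.testBit_and, testBit_bit] at h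
      rcases Bool.or_eq_true _ _ |>.mp h with h | h
      · exact ((Bool.and_eq_true _ _).mp h).1
      · have := ih _ _ h
        rw [Nat.testBit_and] at this
        simp at this
        exact this.1

theorem cliq_card (W f : ℕ) : ∀ R (S : Finset ℕ), Indep W S → Sub S (cliq W f R) →
    S.card ≤ 1 := by
  induction f with
  | zero =>
    intro R S _ hs
    have : S = ∅ := by
      apply Finset.eq_empty_of_forall_notMem
      intro v hv
      have := hs v hv
      simp [cliq] at this
    simp [this]
  | succ f ih =>
    intro R S hi hs
    rw [cliq_succ] at hs
    split_ifs at hs with h0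
    · have : S = ∅ := by
        apply Finset.eq_empty_of_forall_notMem
        intro v hv
        have := hs v hv
        simp at this
      simp [this]
    · by_cases hv : top R ∈ S
      · rw [Finset.card_le_one_iff_subset_singleton]
        refine ⟨top R, fun u hu => ?_⟩
        by_contra hne
        rw [Finset.mem_singleton] at hne
        have h1 := hs u hu
        rw [Nat.testBit_or, Nat.testBit_and, testBit_bit] at h1
        rcases Bool.or_eq_true _ _ |>.mp h1 with h | h
        · exact hne (of_decide_eq_true ((Bool.and_eq_true _ _).mp h).2).symm
        · have h2 := cliq_sub _ _ _ _ h
          rw [Nat.testBit_and] at h2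
          have h3 := hi _ hv u hu (Ne.symm hne)
          rw [h3] at h2
          simp at h2
      · apply ih _ S hi
        intro u hu
        have h1 := hs u hu
        rw [Nat.testBit_or, Nat.testBit_and, testBit_bit] at h1
        rcases Bool.or_eq_true _ _ |>.mp h1 with h | h
        · exact absurd hu (by rw [← of_decide_eq_true ((Bool.and_eq_true _ _).mp h).2]; exact hv)
        · exact h

theorem cover_card (W j : ℕ) : ∀ Q (S : Finset ℕ), Indep W S → Sub S Q →
    (∀ v ∈ S, (cover W j Q).testBit v = false) → S.card ≤ j := by
  induction j with
  | zero =>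
    intro Q S _ hs hn
    have : S = ∅ := by
      apply Finset.eq_empty_of_forall_notMem
      intro v hv
      have h1 := hs v hv
      have h2 : Q.testBit v = false := hn v hv
      rw [h1] at h2
      cases h2
    simp [this]
  | succ j ih =>
    intro Q S hi hs hn
    rw [cover_succ] at hn
    have h1 := cliq_card W 224 Q (S.filter fun v => (cliq W 224 Q).testBit v = true)
      (hi.mono (Finset.filter_subset _ _)) (fun v hv => (Finset.mem_filter.mp hv).2)
    have h2 := ih (Q &&& (Q ^^^ cliq W 224 Q))
      (S.filter fun v => ¬ (cliq W 224 Q).testBit v = true)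
      (hi.mono (Finset.filter_subset _ _))
      (fun v hv => by
        have hv := Finset.mem_filter.mp hv
        rw [Nat.testBit_and, Nat.testBit_xor, hs v hv.1]
        simpa using hv.2)
      (fun v hv => hn v (Finset.mem_filter.mp hv).1)
    have h3 := Finset.card_filter_add_card_filter_not (s := S)
      (fun v => (cliq W 224 Q).testBit v = true)
    omega

theorem branch_sound (W k : ℕ) (s : ℕ → Bool)
    (hsol : ∀ P, s P = true → ∀ S : Finset ℕ, Indep W S → Sub S P → S.card < k) (f : ℕ) :
    ∀ Q P, branch W s f Q P = true → ∀ S : Finset ℕ, Indep W S → Sub S P →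
      (∃ v ∈ S, Q.testBit v = true) → S.card < k + 1 := by
  induction f with
  | zero => intro Q P h; cases h
  | succ f ih =>
    intro Q P h S hi hs hex
    rw [branch_succ] at h
    split_ifs at h with h0
    · obtain ⟨v, _, hv⟩ := hex
      rw [h0] at hv
      simp at hv
    · obtain ⟨h1, h2⟩ := Bool.and_eq_true _ _ |>.mp h
      by_cases hv : top Q ∈ S
      · have := hsol _ h1 (S.erase (top Q)) (hi.mono (Finset.erase_subset _ _))
          (fun u hu => by
            have hu := Finset.mem_erase.mp hu
            rw [testBit_rem, testBit_rem, testBit_bit, hs u hu.2,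
              hi _ hv u hu.2 (Ne.symm hu.1)]
            simpa using Ne.symm hu.1)
        rw [Finset.card_erase_of_mem hv] at this
        omega
      · apply ih _ _ h2 S hi
        · intro u hu
          rw [testBit_rem, testBit_bit, hs u hu]
          have : top Q ≠ u := fun e => hv (e ▸ hu)
          simpa using this
        · obtain ⟨u, hu, hq⟩ := hex
          refine ⟨u, hu, ?_⟩
          rw [testBit_rem, testBit_bit, hq]
          have : top Q ≠ u := fun e => hv (e ▸ hu)
          simpa using this

theorem solve_sound (W k : ℕ) : ∀ P, solve W k P = true → ∀ S : Finset ℕ, Indep W S →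
    Sub S P → S.card < k := by
  induction k with
  | zero => intro P h; cases h
  | succ k ih =>
    intro P h S hi hs
    rw [solve_succ] at h
    by_cases hex : ∃ v ∈ S, (cover W k P).testBit v = true
    · exact branch_sound W k _ ih 224 _ _ h S hi hs hex
    · push Not at hex
      have := cover_card W k P S hi hs (fun v hv => by simpa using hex v hv)
      omega

/-- The code of the difference `u - v` in `Z_112 × Z_2`. -/
def dif (v u : ℕ) : ℕ := 2 * ((u / 2 + 112 - v / 2) % 112) + (u + v) % 2

def evens : ℕ := (2 ^ 224 - 1) / 3

def sw (D : ℕ) : ℕ := (D >>> 1 &&& evens) ||| ((D &&& evens) <<< 1)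

/-- The mask from which all rows are read off by shifting. -/
def mk (D : ℕ) : ℕ := D ||| D <<< 224 ||| sw D <<< 448 ||| sw D <<< 672

theorem evens_lt : evens < 2 ^ 224 := by decide +kernel

theorem testBit_evens_fin : ∀ t : Fin 224, evens.testBit t = decide (t.val % 2 = 0) := by
  decide +kernel

theorem testBit_big {D t : ℕ} (h : D < 2 ^ 224) (ht : 224 ≤ t) : D.testBit t = false :=
  Nat.testBit_lt_two_pow (lt_of_lt_of_le h (Nat.pow_le_pow_right (by norm_num) ht))

theorem testBit_evens (t : ℕ) : evens.testBit t = decide (t < 224 ∧ t % 2 = 0) := by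
  by_cases h : t < 224
  · have := testBit_evens_fin ⟨t, h⟩
    simpa [h] using this
  · rw [testBit_big evens_lt (by omega)]
    simp [h]

theorem testBit_sw (D t : ℕ) : (sw D).testBit t =
    (decide (t < 224) && D.testBit (if t % 2 = 0 then t + 1 else t - 1)) := by
  unfold sw
  rw [Nat.testBit_or, Nat.testBit_and, Nat.testBit_shiftRight, Nat.testBit_shiftLeft,
    Nat.testBit_and, testBit_evens, testBit_evens]
  rcases Nat.mod_two_eq_zero_or_one t with h | h
  · rw [if_pos h, Nat.add_comm 1 t]
    by_cases h2 : t ≥ 1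
    · have h3 : ¬ (t - 1 < 224 ∧ (t - 1) % 2 = 0) := by omega
      rw [decide_eq_false h3]
      cases D.testBit (t + 1) <;> simp [h]
    · rw [decide_eq_false h2]
      cases D.testBit (t + 1) <;> simp [h]
  · have h2 : t ≥ 1 := by omega
    have h3 : (t - 1 < 224 ∧ (t - 1) % 2 = 0) ↔ t < 224 := by omega
    have h4 : ¬ (t < 224 ∧ t % 2 = 0) := by omega
    rw [if_neg (by omega), decide_eq_false h4, decide_eq_true h2,
      show decide (t - 1 < 224 ∧ (t - 1) % 2 = 0) = decide (t < 224) from decide_eq_decide.mpr h3]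
    cases D.testBit (t - 1) <;> simp

theorem row_eq (W v : ℕ) : row W v = W >>> (224 + 449 * (v % 2) - v) := rfl

theorem testBit_mk {D : ℕ} (hD : D < 2 ^ 224) {v u : ℕ} (hv : v < 224) (hu : u < 224) :
    (row (mk D) v).testBit u = D.testBit (dif v u) := by
  rw [row_eq, Nat.testBit_shiftRight, mk, Nat.testBit_or, Nat.testBit_or, Nat.testBit_or,
    Nat.testBit_shiftLeft, Nat.testBit_shiftLeft, Nat.testBit_shiftLeft, testBit_sw, testBit_sw]
  rcases Nat.mod_two_eq_zero_or_one v with h | h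
  · rw [h]
    have e1 : ¬ (224 + 449 * 0 - v + u ≥ 448) := by omega
    have e2 : ¬ (224 + 449 * 0 - v + u ≥ 672) := by omega
    simp only [e1, e2, decide_false, Bool.false_and, Bool.or_false]
    by_cases h1 : 224 + 449 * 0 - v + u < 224
    · have e3 : ¬ (224 + 449 * 0 - v + u ≥ 224) := by omega
      have e4 : dif v u = 224 + 449 * 0 - v + u := by unfold dif; omega
      simp [e3, e4]
    · have e3 : (224 + 449 * 0 - v + u ≥ 224) := by omega
      have e4 : dif v u = 224 + 449 * 0 - v + u - 224 := by unfold dif; omega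
      rw [testBit_big hD e3]
      simp [e3, e4]
  · rw [h]
    have e1 : (224 + 449 * 1 - v + u ≥ 448) := by omega
    have e0 : (224 + 449 * 1 - v + u ≥ 224) := by omega
    have e5 : D.testBit (224 + 449 * 1 - v + u) = false := testBit_big hD e0
    have e6 : D.testBit (224 + 449 * 1 - v + u - 224) = false := testBit_big hD (by omega)
    rw [e5, e6]
    by_cases h1 : 224 + 449 * 1 - v + u < 672
    · have e3 : ¬ (224 + 449 * 1 - v + u ≥ 672) := by omega
      have e4 : dif v u = (if (224 + 449 * 1 - v + u - 448) % 2 = 0 then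
        224 + 449 * 1 - v + u - 448 + 1 else 224 + 449 * 1 - v + u - 448 - 1) := by
        unfold dif; split_ifs <;> omega
      have e7 : 224 + 449 * 1 - v + u - 448 < 224 := by omega
      rw [← e4]
      simp [e1, e3, e7]
    · have e3 : (224 + 449 * 1 - v + u ≥ 672) := by omega
      have e4 : dif v u = (if (224 + 449 * 1 - v + u - 672) % 2 = 0 then
        224 + 449 * 1 - v + u - 672 + 1 else 224 + 449 * 1 - v + u - 672 - 1) := by
        unfold dif; split_ifs <;> omega
      have e7 : 224 + 449 * 1 - v + u - 672 < 224 := by omega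
      have e8 : ¬ 224 + 449 * 1 - v + u - 448 < 224 := by omega
      rw [← e4]
      simp [e3, e7, e8]

theorem dif_lt (v u : ℕ) : dif v u < 224 := by unfold dif; omega

theorem dif_self (v : ℕ) : dif v v = 0 := by unfold dif; omega

theorem dif_div (v u : ℕ) : dif v u / 2 = (u / 2 + 112 - v / 2) % 112 := by
  unfold dif; omega

theorem dif_mod (v u : ℕ) : dif v u % 2 = (u + v) % 2 := by
  unfold dif; omega

theorem mod_aux {a b c : ℕ} (ha : a < 112) (hb : b < 112) (hc : c < 112) :
    ((c + 112 - a) % 112 + 112 - (b + 112 - a) % 112) % 112 = (c + 112 - b) % 112 := by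
  have h1 : (c + 112 - a) % 112 = if a ≤ c then c - a else c + 112 - a := by
    split_ifs <;> omega
  have h2 : (b + 112 - a) % 112 = if a ≤ b then b - a else b + 112 - a := by
    split_ifs <;> omega
  rw [h1, h2]
  split_ifs <;> omega

theorem dif_dif {v x y : ℕ} (hv : v < 224) (hx : x < 224) (hy : y < 224) :
    dif (dif v x) (dif v y) = dif x y := by
  have h1 : (dif v y + dif v x) % 2 = (y + x) % 2 := by
    have h1 := dif_mod v x
    have h2 := dif_mod v y
    omega
  have h2 := mod_aux (a := v / 2) (b := x / 2) (c := y / 2) (by omega) (by omega) (by omega)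
  rw [dif, h1, dif_div, dif_div, h2, dif]

theorem dif_inj {v x y : ℕ} (hv : v < 224) (hx : x < 224) (hy : y < 224)
    (h : dif v x = dif v y) : x = y := by
  have h1 := dif_mod v x
  have h2 := dif_mod v y
  have h3 := dif_div v x
  have h4 := dif_div v y
  rw [h] at h1 h3
  omega

theorem dif_ne {v x : ℕ} (hv : v < 224) (hx : x < 224) (h : v ≠ x) : dif v x ≠ 0 := by
  intro h0
  rw [← dif_self v] at h0
  exact h (dif_inj hv hx hv h0).symm

theorem dif_swap {v x : ℕ} (hv : v < 224) (hx : x < 224) : dif x v = dif (dif v x) 0 := by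
  rw [← dif_dif hv hx hv, dif_self]

theorem dif_neg_neg {d : ℕ} (hd : d < 224) : dif (dif d 0) 0 = d := by
  rw [← dif_swap hd (by norm_num)]
  unfold dif; omega

/-- All the vertices other than `0`, `d` that are adjacent to neither. -/
def start (W d : ℕ) : ℕ :=
  rem (rem (rem (rem (2 ^ 224 - 1) (row W 0)) (row W d)) (bit 0)) (bit d)

def check (k : ℕ) : List ℕ → ℕ → Bool
  | [], D => D == 2 ^ 224 - 2
  | d :: ds, D =>
    force (mk D) (fun W => force (start W d) fun P => solve W k P) &&
      force (D ||| bit d ||| bit (dif d 0)) (fun D' => check k ds D')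

/-- One step of `check`. -/
def one (k d D : ℕ) : Bool := force (mk D) (fun W => force (start W d) fun P => solve W k P)

def next (D d : ℕ) : ℕ := D ||| bit d ||| bit (dif d 0)

theorem check_cons {k d D : ℕ} {ds : List ℕ} (h : one k d D = true)
    (h' : check k ds (next D d) = true) : check k (d :: ds) D = true := by
  rw [check, force_eq (D ||| bit d ||| bit (dif d 0))]
  exact (Bool.and_eq_true _ _).mpr ⟨h, h'⟩

theorem testBit_full (u : ℕ) (h : u < 224) : (2 ^ 224 - 1 : ℕ).testBit u = true := by
  rw [Nat.testBit_two_pow_sub_one]; simpa using h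

theorem testBit_full' : ∀ u : Fin 224, u.val ≠ 0 → (2 ^ 224 - 2 : ℕ).testBit u = true := by
  decide +kernel

theorem check_sound (k : ℕ) (ds : List ℕ) : (∀ d ∈ ds, d < 224) → ∀ D < 2 ^ 224,
    check k ds D = true → ∀ S : Finset ℕ, (∀ v ∈ S, v < 224) →
    (∀ v ∈ S, ∀ u ∈ S, v ≠ u → D.testBit (dif v u) = false) → S.card < k + 2 := by
  induction ds with
  | nil =>
    intro _ D _ h S hS hi
    have hD : D = 2 ^ 224 - 2 := by simpa [check] using h
    have : S.card ≤ 1 := by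
      rw [Finset.card_le_one]
      intro a ha b hb
      by_contra hne
      have h1 := hi a ha b hb hne
      have h2 := testBit_full' ⟨dif a b, dif_lt a b⟩ (dif_ne (hS a ha) (hS b hb) hne)
      rw [hD] at h1
      rw [h1] at h2
      cases h2
    omega
  | cons d ds ih =>
    intro hds D hD h S hS hi
    have hd : d < 224 := hds d (by simp)
    rw [check, force_eq, force_eq, force_eq] at h
    obtain ⟨h1, h2⟩ := Bool.and_eq_true _ _ |>.mp h
    have hb : ∀ x < 224, bit x < 2 ^ 224 := by
      intro x hx
      change 1 <<< x < 2 ^ 224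
      rw [Nat.one_shiftLeft]
      exact Nat.pow_lt_pow_right (by norm_num) hx
    by_cases hall : ∀ v ∈ S, ∀ u ∈ S, v ≠ u →
        (D ||| bit d ||| bit (dif d 0)).testBit (dif v u) = false
    · exact ih (fun x hx => hds x (by simp [hx])) _
        (Nat.or_lt_two_pow (Nat.or_lt_two_pow hD (hb d hd)) (hb _ (dif_lt _ _))) h2 S hS hall
    · have key : ∃ v ∈ S, ∃ u ∈ S, v ≠ u ∧ dif v u = d := by
        push Not at hall
        obtain ⟨v, hv, u, hu, hne, hh⟩ := hall
        rw [Nat.testBit_or, Nat.testBit_or, hi v hv u hu hne, testBit_bit, testBit_bit] at hh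
        by_cases e : d = dif v u
        · exact ⟨v, hv, u, hu, hne, e.symm⟩
        · have e' : dif d 0 = dif v u := by simpa [e] using hh
          refine ⟨u, hu, v, hv, hne.symm, ?_⟩
          rw [dif_swap (hS v hv) (hS u hu), ← e', dif_neg_neg hd]
      obtain ⟨v, hv, u, hu, hne, e⟩ := key
      have hv' := hS v hv
      have hu' := hS u hu
      have hsub : ((S.erase v).erase u).card = S.card - 2 := by
        rw [Finset.card_erase_of_mem (Finset.mem_erase.mpr ⟨hne.symm, hu⟩),
          Finset.card_erase_of_mem hv]
        omega
      have hcard : (((S.erase v).erase u).image (dif v)).card = S.card - 2 := by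
        rw [← hsub]
        apply Finset.card_image_of_injOn
        intro x hx y hy hxy
        have hx : x ∈ S := Finset.mem_of_mem_erase (Finset.mem_of_mem_erase hx)
        have hy : y ∈ S := Finset.mem_of_mem_erase (Finset.mem_of_mem_erase hy)
        exact dif_inj hv' (hS x hx) (hS y hy) hxy
      have := solve_sound _ _ _ h1 (((S.erase v).erase u).image (dif v))
        (by
          intro a ha b hb hab
          obtain ⟨x, hx, rfl⟩ := Finset.mem_image.mp ha
          obtain ⟨y, hy, rfl⟩ := Finset.mem_image.mp hb
          have hx : x ∈ S := Finset.mem_of_mem_erase (Finset.mem_of_mem_erase hx)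
          have hy : y ∈ S := Finset.mem_of_mem_erase (Finset.mem_of_mem_erase hy)
          rw [testBit_mk hD (dif_lt _ _) (dif_lt _ _), dif_dif hv' (hS x hx) (hS y hy)]
          exact hi x hx y hy (fun e => hab (by rw [e])))
        (by
          intro a ha
          obtain ⟨x, hx, rfl⟩ := Finset.mem_image.mp ha
          have hxu : x ≠ u := (Finset.mem_erase.mp hx).1
          have hx := (Finset.mem_erase.mp hx).2
          have hxv : x ≠ v := (Finset.mem_erase.mp hx).1
          have hx := (Finset.mem_erase.mp hx).2
          have hx' := hS x hx
          have a1 : (row (mk D) 0).testBit (dif v x) = false := by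
            rw [testBit_mk hD (by norm_num) (dif_lt _ _)]
            have := dif_dif hv' hv' hx'
            rw [dif_self] at this
            rw [this]
            exact hi v hv x hx hxv.symm
          have a2 : (row (mk D) d).testBit (dif v x) = false := by
            rw [testBit_mk hD hd (dif_lt _ _), ← e, dif_dif hv' hu' hx']
            exact hi u hu x hx hxu.symm
          have a3 : ¬ (0 = dif v x) := fun h => dif_ne hv' hx' hxv.symm h.symm
          have a4 : ¬ (d = dif v x) := fun h => hxu (dif_inj hv' hx' hu' (by rw [e, h]))
          rw [start, testBit_rem, testBit_rem, testBit_rem, testBit_rem, a1, a2,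
            testBit_bit, testBit_bit, testBit_full _ (dif_lt _ _)]
          simp [a3, a4])
      omega

/-- The connection set of the Cayley graph, as a bit mask. -/
def conn : ℕ :=
  23804001438225352340307471010345585367354420171940671016550752617006

/-- The connection set of the complementary graph. -/
def coconn : ℕ :=
  3155945228925287454359544076674045306282724250599901464552857632208

def orderIndep : List ℕ :=
  [98, 61, 93, 57, 69, 58, 6, 109, 41, 74, 77, 17, 106, 82, 10, 45, 49, 53, 14, 22, 81, 89, 86, 38, 13, 21, 78, 46, 54, 70, 105, 36, 96, 12, 72, 99, 67, 19, 75, 11, 56, 7, 87, 48, 24, 108, 100, 32, 91, 59, 92, 23, 16, 55, 60, 51, 64, 27, 103, 84, 8, 68, 31, 107, 80, 4, 35, 111, 76, 39]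

def orderClique : List ℕ :=
  [1, 2, 3, 5, 9, 15, 18, 20, 25, 26, 28, 29, 30, 33, 34, 37, 40, 42, 43, 44, 47, 50, 52, 62, 63, 65, 66, 71, 73, 79, 83, 85, 88, 90, 94, 95, 97, 101, 102, 104, 110, 112, 113]

/-! The first steps are checked one by one, which keeps the caches of the kernel small. -/

def mask1 : ℕ := next conn 98

theorem one0 : one 11 98 conn = true := by decide +kernel

def mask2 : ℕ := next mask1 61

theorem one1 : one 11 61 mask1 = true := by decide +kernel

def mask3 : ℕ := next mask2 93

theorem one2 : one 11 93 mask2 = true := by decide +kernel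

def mask4 : ℕ := next mask3 57

theorem one3 : one 11 57 mask3 = true := by decide +kernel

def mask5 : ℕ := next mask4 69

theorem one4 : one 11 69 mask4 = true := by decide +kernel

def mask6 : ℕ := next mask5 58

theorem one5 : one 11 58 mask5 = true := by decide +kernel

def mask7 : ℕ := next mask6 6

theorem one6 : one 11 6 mask6 = true := by decide +kernel

def mask8 : ℕ := next mask7 109

theorem one7 : one 11 109 mask7 = true := by decide +kernel

def mask9 : ℕ := next mask8 41

theorem one8 : one 11 41 mask8 = true := by decide +kernel

def mask10 : ℕ := next mask9 74

theorem one9 : one 11 74 mask9 = true := by decide +kernel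

def mask11 : ℕ := next mask10 77

theorem one10 : one 11 77 mask10 = true := by decide +kernel

def mask12 : ℕ := next mask11 17

theorem one11 : one 11 17 mask11 = true := by decide +kernel

def mask13 : ℕ := next mask12 106

theorem one12 : one 11 106 mask12 = true := by decide +kernel

theorem check_rest : check 11
    [82, 10, 45, 49, 53, 14, 22, 81, 89, 86, 38, 13, 21, 78, 46, 54, 70, 105, 36, 96, 12, 72, 99, 67, 19, 75, 11, 56, 7, 87, 48, 24, 108, 100, 32, 91, 59, 92, 23, 16, 55, 60, 51, 64, 27, 103, 84, 8, 68, 31, 107, 80, 4, 35, 111, 76, 39]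
    mask13 = true := by decide +kernel

theorem check_indep : check 11 orderIndep conn = true :=
  check_cons one0 <| check_cons one1 <| check_cons one2 <| check_cons one3 <| 
    check_cons one4 <| check_cons one5 <| check_cons one6 <| check_cons one7 <| 
    check_cons one8 <| check_cons one9 <| check_cons one10 <| check_cons one11 <| 
    check_cons one12 <| check_rest

theorem check_clique : check 3 orderClique coconn = true := by decide +kernel

theorem conn_lt : conn < 2 ^ 224 := by decide +kernel

theorem coconn_lt : coconn < 2 ^ 224 := by decide +kernel

theorem conn_coconn : ∀ t : Fin 224, conn.testBit t = true → coconn.testBit t = false := by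
  decide +kernel

theorem conn_symm : ∀ t : Fin 224, conn.testBit t = conn.testBit (dif t 0) := by
  decide +kernel

theorem conn_zero : conn.testBit 0 = false := by decide +kernel

def graph : SimpleGraph (Fin 217) where
  Adj a b := conn.testBit (dif a.val b.val) = true
  symm := ⟨fun a b h => by
    rw [dif_swap (v := a.val) (x := b.val) (by omega) (by omega)]
    rw [← conn_symm ⟨dif a.val b.val, dif_lt _ _⟩]
    exact h⟩
  loopless := ⟨fun a h => by
    rw [dif_self, conn_zero] at h
    cases h⟩

end Ramsey513

open Ramsey513 in
theorem ramsey_lower_bound_R_5_13 :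
    ∃ G : SimpleGraph (Fin 217), G.CliqueFree 5 ∧ Gᶜ.CliqueFree 13 := by
  refine ⟨graph, ?_, ?_⟩
  · intro s hs
    have := check_sound 3 orderClique (by decide +kernel) coconn coconn_lt check_clique
      (s.map Fin.valEmbedding)
      (by
        intro v hv
        obtain ⟨a, _, rfl⟩ := Finset.mem_map.mp hv
        have := a.isLt
        simp only [Fin.valEmbedding_apply]
        omega)
      (by
        intro v hv u hu hne
        obtain ⟨a, ha, rfl⟩ := Finset.mem_map.mp hv
        obtain ⟨b, hb, rfl⟩ := Finset.mem_map.mp hu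
        have hab : a ≠ b := fun e => hne (by rw [e])
        exact conn_coconn ⟨_, dif_lt _ _⟩ (hs.1 ha hb hab))
    rw [Finset.card_map, hs.2] at this
    omega
  · intro s hs
    have := check_sound 11 orderIndep (by decide +kernel) conn conn_lt check_indep
      (s.map Fin.valEmbedding)
      (by
        intro v hv
        obtain ⟨a, _, rfl⟩ := Finset.mem_map.mp hv
        have := a.isLt
        simp only [Fin.valEmbedding_apply]
        omega)
      (by
        intro v hv u hu hne
        obtain ⟨a, ha, rfl⟩ := Finset.mem_map.mp hv
        obtain ⟨b, hb, rfl⟩ := Finset.mem_map.mp hu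
        have hab : a ≠ b := fun e => hne (by rw [e])
        have := (SimpleGraph.compl_adj _ _ _).mp (hs.1 ha hb hab)
        simpa [graph] using this.2)
    rw [Finset.card_map, hs.2] at this
    omega
end

section
/- R(5,15) ≥ 269; that is, there exists a 2-coloring of the edges of the complete graph K_268 containing no monochromatic K_5 in color 1 and no monochromatic K_15 in color 2. -/
namespace R515
/-- evaluate `x` before passing it on -/
def force {α : Type} (x : Nat) (f : Nat → α) (z : α) : α :=
  Nat.rec (motive := fun _ => α) z (fun m _ => f m) (Nat.add x 1)

/-- peel greedily a clique off `U`, candidates `Q` -/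
def cls (T D : Nat) (n : Nat) : Nat → Nat → Nat :=
  Nat.rec (motive := fun _ => Nat → Nat → Nat) (fun U _ => U)
    (fun _ ih U Q => Bool.rec (motive := fun _ => Nat) U
      ((fun b => force (Nat.xor U b)
          (fun U' => force (Nat.land Q (Nat.shiftRight (Nat.mul D b) 862)) (ih U') U) U)
        (Nat.xor Q (Nat.land Q (Nat.sub Q T))))
      (Nat.ble T Q)) n

def col (T D : Nat) (c : Nat) : Nat → Nat :=
  Nat.rec (motive := fun _ => Nat → Nat) (fun U => U)
    (fun _ ih U => Bool.rec (motive := fun _ => Nat) U (force (cls T D 266 U U) ih U) (Nat.ble T U)) c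

def tg (x : Nat) : Nat := Nat.lor x (Nat.mod x 2305843009213693921)

def bk (T D : Nat) (S : Nat → Bool) (n : Nat) : Nat → Nat → Bool :=
  Nat.rec (motive := fun _ => Nat → Nat → Bool) (fun _ _ => false)
    (fun _ ih U P => Bool.rec (motive := fun _ => Bool) true
      (force (Nat.land U (Nat.sub U T)) (fun U' =>
        force (Nat.xor P (Nat.xor U U'))
          (fun P' => Bool.rec (motive := fun _ => Bool) false (ih U' P')
             (force (tg (Nat.xor P' (Nat.land P' (Nat.shiftRight (Nat.mul D (Nat.xor U U')) 862)))) S false))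
          false) false) (Nat.ble T U)) n

def srch (T D : Nat) (k : Nat) : Nat → Bool :=
  Nat.rec (motive := fun _ => Nat → Bool) (fun _ => false)
    (fun k ih P => force (col T D k P) (fun U => bk T D ih 266 U P) false) k

def H : List Nat := [1, 39, 75, 191, 227, 265]

def msk (L : List Nat) : Nat :=
  L.foldr (fun r a => H.foldr (fun h b => b ||| (1 <<< (h * r % 266))) a) 0

def dbl (M : Nat) : Nat := M ||| (M <<< 266)

def dd (M : Nat) : Nat := (2 ^ 596 - 1) ||| (dbl M <<< 596)

def full : Nat := 2 ^ 266 - 1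

def cand (M a e : Nat) : Nat :=
  (full ^^^ (full &&& (((dbl M >>> (266 - a)) ||| (dbl M >>> (266 - e))) |||
    ((1 <<< a) ||| (1 <<< e))))) <<< 330

def chk1 (k : Nat) (L : List Nat) (d a : Nat) : Bool :=
  force (msk L) (fun M => force (dd M) (fun D => force (cand M a ((d + a) % 266)) (fun P =>
    force (2 ^ 330) (fun T => srch T D k P) false) false) false) false

def reds : List Nat :=
  [4, 5, 7, 8, 9, 16, 19, 21, 24, 26, 28, 35, 37, 49, 52, 58, 63, 70, 73, 91, 105, 112, 133]

theorem force_eq {α : Type} (x : Nat) (f : Nat → α) (z : α) : force x f z = f x := rfl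

def adj (D u v : Nat) : Bool := ((D * 2 ^ (330 + v)) >>> 862).testBit (330 + u)

def Ind (D : Nat) (S : Finset Nat) : Prop := ∀ u ∈ S, ∀ v ∈ S, u ≠ v → adj D u v = false

theorem low_aux : ∀ q : Nat, 0 < q →
    ∃ v, q.testBit v = true ∧ q ^^^ (q &&& (q - 1)) = 2 ^ v := by
  intro q
  induction q using Nat.strong_induction_on with
  | _ q ih =>
    intro hq
    rcases Nat.even_or_odd' q with ⟨r, rfl | rfl⟩
    · obtain ⟨v, hv, he⟩ := ih r (by omega) (by omega)
      refine ⟨v + 1, ?_, ?_⟩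
      · rw [Nat.testBit_succ]; simpa using hv
      · apply Nat.eq_of_testBit_eq
        intro i
        have he' := congrArg (fun z => z.testBit (i - 1)) he
        cases i with
        | zero => simp [Nat.testBit_zero, Nat.pow_succ]
        | succ i =>
          have a1 : (2 * r).testBit (i + 1) = r.testBit i := by
            rw [Nat.testBit_succ]; congr 1; omega
          have a2 : (2 * r - 1).testBit (i + 1) = (r - 1).testBit i := by
            rw [Nat.testBit_succ]; congr 1; omega
          have a3 : (2 ^ (v + 1)).testBit (i + 1) = (2 ^ v).testBit i := by
            rw [Nat.testBit_succ]; congr 1; rw [Nat.pow_succ]; omega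
          simp only [Nat.add_sub_cancel, Nat.testBit_xor, Nat.testBit_and] at he'
          rw [Nat.testBit_xor, Nat.testBit_and, a1, a2, a3]
          exact he'
    · refine ⟨0, by simp, ?_⟩
      apply Nat.eq_of_testBit_eq
      intro i
      cases i with
      | zero =>
        rw [Nat.testBit_xor, Nat.testBit_and, Nat.add_sub_cancel]
        simp [Nat.testBit_zero]
      | succ i =>
        have a1 : (2 * r).testBit (i + 1) = r.testBit i := by
          rw [Nat.testBit_succ]; congr 1; omega
        have a2 : (2 * r + 1).testBit (i + 1) = r.testBit i := by
          rw [Nat.testBit_succ]; congr 1; omega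
        have a3 : (2 ^ 0).testBit (i + 1) = false := by
          rw [Nat.testBit_succ]; simp
        rw [Nat.testBit_xor, Nat.testBit_and, Nat.add_sub_cancel, a1, a2, a3]
        cases r.testBit i <;> rfl

theorem low_bit (Q : Nat) (h : 2 ^ 330 ≤ Q) :
    ∃ v, Q.testBit (330 + v) = true ∧ Q ^^^ (Q &&& (Q - 2 ^ 330)) = 2 ^ (330 + v) := by
  generalize 330 = O at *
  have hp : 0 < 2 ^ O := by positivity
  obtain ⟨v, hv, he⟩ := low_aux (Q / 2 ^ O) (Nat.div_pos h hp)
  have hd : (Q - 2 ^ O) / 2 ^ O = Q / 2 ^ O - 1 := by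
    simpa using Nat.sub_mul_div Q (2 ^ O) 1
  have hm : (Q - 2 ^ O) % 2 ^ O = Q % 2 ^ O := by
    rw [← Nat.mod_eq_sub_mod h]
  refine ⟨v, ?_, ?_⟩
  · rw [Nat.testBit_div_two_pow] at hv
    rwa [Nat.add_comm]
  · apply Nat.eq_of_testBit_eq
    intro i
    by_cases hi : i < O
    · have h1 : Q.testBit i = (Q % 2 ^ O).testBit i := by simp [Nat.testBit_mod_two_pow, hi]
      have h2 : (Q - 2 ^ O).testBit i = ((Q - 2 ^ O) % 2 ^ O).testBit i := by
        simp [Nat.testBit_mod_two_pow, hi]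
      rw [Nat.testBit_xor, Nat.testBit_and, h2, hm, ← h1, Nat.testBit_two_pow]
      have : O + v ≠ i := by omega
      simp [this]
    · obtain ⟨j, rfl⟩ := Nat.exists_eq_add_of_le (Nat.le_of_not_lt hi)
      have he' := congrArg (fun z => z.testBit j) he
      simp only [Nat.testBit_xor, Nat.testBit_and, ← hd, Nat.testBit_div_two_pow] at he'
      rw [Nat.testBit_xor, Nat.testBit_and, Nat.add_comm O j, he', Nat.testBit_two_pow,
        Nat.testBit_two_pow]
      simp [Nat.add_comm O v]

theorem cls_zero (T D U Q : Nat) : cls T D 0 U Q = U := rfl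

theorem cls_succ (T D n U Q : Nat) : cls T D (n + 1) U Q =
    if T ≤ Q then cls T D n (U ^^^ (Q ^^^ (Q &&& (Q - T))))
      (Q &&& ((D * (Q ^^^ (Q &&& (Q - T)))) >>> 862)) else U := by
  have h : cls T D (n + 1) U Q = Bool.rec (motive := fun _ => Nat) U
      (cls T D n (U ^^^ (Q ^^^ (Q &&& (Q - T))))
      (Q &&& ((D * (Q ^^^ (Q &&& (Q - T)))) >>> 862))) (Nat.ble T Q) := rfl
  rw [h]
  by_cases hb : T ≤ Q
  · rw [if_pos hb, Nat.ble_eq_true_of_le hb]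
  · rw [if_neg hb]
    have : Nat.ble T Q = false := by
      rw [Bool.eq_false_iff]; intro h; exact hb (Nat.le_of_ble_eq_true h)
    rw [this]

theorem cls_spec (D : Nat) (S : Finset Nat) (hS : Ind D S) : ∀ n U Q,
    (∀ x ∈ S, U.testBit (330 + x) = true → (cls (2 ^ 330) D n U Q).testBit (330 + x) = false →
      Q.testBit (330 + x) = true) ∧
    (∀ x ∈ S, ∀ y ∈ S, U.testBit (330 + x) = true →
      (cls (2 ^ 330) D n U Q).testBit (330 + x) = false →
      U.testBit (330 + y) = true → (cls (2 ^ 330) D n U Q).testBit (330 + y) = false → x = y) := by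
  intro n
  induction n with
  | zero =>
    intro U Q
    simp only [cls_zero]
    exact ⟨fun x _ h1 h2 => by simp [h1] at h2, fun x _ y _ h1 h2 => by simp [h1] at h2⟩
  | succ n ih =>
    intro U Q
    rw [cls_succ]
    split_ifs with h
    · obtain ⟨v, hv, hb⟩ := low_bit Q h
      rw [hb]
      obtain ⟨ih1, ih2⟩ := ih (U ^^^ 2 ^ (330 + v)) (Q &&& ((D * 2 ^ (330 + v)) >>> 862))
      generalize cls (2 ^ 330) D n (U ^^^ 2 ^ (330 + v))
        (Q &&& ((D * 2 ^ (330 + v)) >>> 862)) = R at *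
      have key : ∀ x, x ≠ v → U.testBit (330 + x) = true →
          (U ^^^ 2 ^ (330 + v)).testBit (330 + x) = true := by
        intro x hx hU
        rw [Nat.testBit_xor, Nat.testBit_two_pow, hU]
        have : ¬ (330 + v = 330 + x) := by omega
        rw [decide_eq_false this]; rfl
      have key2 : ∀ x ∈ S, x ≠ v → U.testBit (330 + x) = true → R.testBit (330 + x) = false →
          Q.testBit (330 + x) = true ∧ adj D x v = true := by
        intro x hx hxv hU hR
        have := ih1 x hx (key x hxv hU) hR
        rw [Nat.testBit_and, Bool.and_eq_true] at this
        exact this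
      refine ⟨?_, ?_⟩
      · intro x hx hU hR
        by_cases hxv : x = v
        · rw [hxv]; exact hv
        · exact (key2 x hx hxv hU hR).1
      · intro x hx y hy hU hR hU' hR'
        by_cases hxv : x = v
        · by_cases hyv : y = v
          · rw [hxv, hyv]
          · have h1 := (key2 y hy hyv hU' hR').2
            rw [← hxv, hS y hy x hx (by rw [hxv]; exact hyv)] at h1
            exact absurd h1 (by simp)
        · by_cases hyv : y = v
          · have h1 := (key2 x hx hxv hU hR).2
            rw [← hyv, hS x hx y hy (by rw [hyv]; exact hxv)] at h1
            exact absurd h1 (by simp)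
          · exact ih2 x hx y hy (key x hxv hU) hR (key y hyv hU') hR'
    · exact ⟨fun x _ h1 h2 => by simp [h1] at h2, fun x _ y _ h1 h2 => by simp [h1] at h2⟩

theorem col_succ (T D c U : Nat) : col T D (c + 1) U =
    Bool.rec (motive := fun _ => Nat) U (col T D c (cls T D 266 U U)) (Nat.ble T U) := rfl

theorem col_zero (T D U : Nat) : col T D 0 U = U := rfl

theorem col_spec (D : Nat) (S : Finset Nat) (hS : Ind D S) : ∀ c U,
    (S.filter (fun x => U.testBit (330 + x) = true ∧
      (col (2 ^ 330) D c U).testBit (330 + x) = false)).card ≤ c := by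
  intro c
  induction c with
  | zero =>
    intro U
    rw [col_zero, Nat.le_zero, Finset.card_eq_zero, Finset.filter_eq_empty_iff]
    rintro x - ⟨h1, h2⟩
    simp [h1] at h2
  | succ c ih =>
    intro U
    rw [col_succ]
    cases Nat.ble (2 ^ 330) U with
    | false =>
      have : (S.filter (fun x => U.testBit (330 + x) = true ∧
          U.testBit (330 + x) = false)) = ∅ := by
        rw [Finset.filter_eq_empty_iff]
        rintro x - ⟨h1, h2⟩
        simp [h1] at h2
      show (S.filter (fun x => U.testBit (330 + x) = true ∧
          U.testBit (330 + x) = false)).card ≤ c + 1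
      rw [this]; simp
    | true =>
      show (S.filter (fun x => U.testBit (330 + x) = true ∧
          (col (2 ^ 330) D c (cls (2 ^ 330) D 266 U U)).testBit (330 + x) = false)).card ≤ c + 1
      have h1 := ih (cls (2 ^ 330) D 266 U U)
      have h2 := (cls_spec D S hS 266 U U).2
      generalize cls (2 ^ 330) D 266 U U = V at *
      have h3 : (S.filter (fun x => U.testBit (330 + x) = true ∧
          V.testBit (330 + x) = false)).card ≤ 1 := by
        rw [Finset.card_le_one]
        intro x hx y hy
        rw [Finset.mem_filter] at hx hy
        exact h2 x hx.1 y hy.1 hx.2.1 hx.2.2 hy.2.1 hy.2.2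
      refine le_trans (Finset.card_le_card (t := (S.filter (fun x => V.testBit (330 + x) = true ∧
          (col (2 ^ 330) D c V).testBit (330 + x) = false)) ∪
          (S.filter (fun x => U.testBit (330 + x) = true ∧ V.testBit (330 + x) = false))) ?_)
          (le_trans (Finset.card_union_le _ _) (Nat.add_le_add h1 h3))
      intro x hx
      rw [Finset.mem_filter] at hx
      rw [Finset.mem_union, Finset.mem_filter, Finset.mem_filter]
      by_cases hV : V.testBit (330 + x) = true
      · exact Or.inl ⟨hx.1, hV, hx.2.2⟩
      · exact Or.inr ⟨hx.1, hx.2.1, by simpa using hV⟩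

theorem tg_bit (R x : Nat) : (tg R).testBit (330 + x) = R.testBit (330 + x) := by
  have h : tg R = R ||| (R % 2305843009213693921) := rfl
  rw [h, Nat.testBit_or]
  have h2 : (R % 2305843009213693921).testBit (330 + x) = false := by
    apply Nat.testBit_lt_two_pow
    calc R % 2305843009213693921 < 2305843009213693921 := Nat.mod_lt _ (by norm_num)
      _ ≤ 2 ^ 62 := by norm_num
      _ ≤ 2 ^ (330 + x) := Nat.pow_le_pow_right (by norm_num) (by omega)
  rw [h2, Bool.or_false]

theorem bk_succ (T D n U P : Nat) (F : Nat → Bool) : bk T D F (n + 1) U P =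
    Bool.rec (motive := fun _ => Bool) true
      (Bool.rec (motive := fun _ => Bool) false
        (bk T D F n (U &&& (U - T)) (P ^^^ (U ^^^ (U &&& (U - T)))))
        (F (tg ((P ^^^ (U ^^^ (U &&& (U - T)))) ^^^ ((P ^^^ (U ^^^ (U &&& (U - T)))) &&&
          ((D * (U ^^^ (U &&& (U - T)))) >>> 862))))))
      (Nat.ble T U) := rfl

theorem bk_zero (T D U P : Nat) (F : Nat → Bool) : bk T D F 0 U P = false := rfl

theorem srch_zero (T D P : Nat) : srch T D 0 P = false := rfl

theorem srch_succ (T D k P : Nat) :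
    srch T D (k + 1) P = bk T D (srch T D k) 266 (col T D k P) P := by
  have h : srch T D (k + 1) P =
      force (col T D k P) (fun U => bk T D (srch T D k) 266 U P) false := by
    unfold srch
    generalize (266 : Nat) = N
    rfl
  rw [h, force_eq]

theorem bk_spec (D k : Nat) (F : Nat → Bool)
    (hF : ∀ P, F P = true → ∀ S : Finset Nat, Ind D S →
      (∀ x ∈ S, P.testBit (330 + x) = true) → S.card ≠ k)
    (S : Finset Nat) (hS : Ind D S) (hc : S.card = k + 1) : ∀ n U P,
    bk (2 ^ 330) D F n U P = true → (∀ x ∈ S, P.testBit (330 + x) = true) →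
    ∀ x ∈ S, U.testBit (330 + x) = false := by
  intro n
  induction n with
  | zero => intro U P h; rw [bk_zero] at h; exact absurd h (by simp)
  | succ n ih =>
    intro U P h hP
    rw [bk_succ] at h
    by_cases hT : 2 ^ 330 ≤ U
    · rw [Nat.ble_eq_true_of_le hT] at h
      obtain ⟨v, hv, hb⟩ := low_bit U hT
      rw [hb] at h
      have hbit : ∀ x, x ≠ v → (2 ^ (330 + v)).testBit (330 + x) = false := by
        intro x hx
        rw [Nat.testBit_two_pow]
        have : ¬ (330 + v = 330 + x) := by omega
        exact decide_eq_false this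
      have hP' : ∀ x ∈ S, x ≠ v → (P ^^^ 2 ^ (330 + v)).testBit (330 + x) = true := by
        intro x hx hxv
        rw [Nat.testBit_xor, hbit x hxv, hP x hx]; rfl
      generalize hR : tg ((P ^^^ 2 ^ (330 + v)) ^^^ ((P ^^^ 2 ^ (330 + v)) &&&
          ((D * 2 ^ (330 + v)) >>> 862))) = R at h
      cases hFR : F R with
      | false => rw [hFR] at h; exact absurd h (by show ¬ (false = true); simp)
      | true =>
        rw [hFR] at h
        have h' : bk (2 ^ 330) D F n (U &&& (U - 2 ^ 330)) (P ^^^ 2 ^ (330 + v)) = true := h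
        have hvS : v ∉ S := by
          intro hvS
          refine hF R hFR (S.erase v) ?_ ?_ ?_
          · intro x hx y hy
            exact hS x (Finset.mem_of_mem_erase hx) y (Finset.mem_of_mem_erase hy)
          · intro x hx
            have hxv := Finset.ne_of_mem_erase hx
            have hxS := Finset.mem_of_mem_erase hx
            have ha : adj D x v = false := hS x hxS v hvS hxv
            unfold adj at ha
            rw [← hR, tg_bit, Nat.testBit_xor, Nat.testBit_and, hP' x hxS hxv, ha]; rfl
          · rw [Finset.card_erase_of_mem hvS, hc]; rfl
        have hne : ∀ x ∈ S, x ≠ v := fun x hx hxv => hvS (hxv ▸ hx)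
        have h1 := ih _ _ h' (fun x hx => hP' x hx (hne x hx))
        intro x hx
        have h2 := h1 x hx
        have h3 := congrArg (fun z => z.testBit (330 + x)) hb
        simp only [Nat.testBit_xor] at h3
        rw [h2, hbit x (hne x hx)] at h3
        simpa using h3
    · intro x hx
      apply Nat.testBit_lt_two_pow
      exact lt_of_lt_of_le (Nat.lt_of_not_le hT) (Nat.pow_le_pow_right (by norm_num) (by omega))

theorem srch_spec (D : Nat) : ∀ k P, srch (2 ^ 330) D k P = true →
    ∀ S : Finset Nat, Ind D S → (∀ x ∈ S, P.testBit (330 + x) = true) → S.card ≠ k := by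
  intro k
  induction k with
  | zero => intro P h; rw [srch_zero] at h; exact absurd h (by simp)
  | succ k ih =>
    intro P h S hS hP hc
    rw [srch_succ] at h
    have h1 := bk_spec D k _ ih S hS hc _ _ _ h hP
    have h2 := col_spec D S hS k P
    rw [Finset.filter_true_of_mem (fun x hx => ⟨hP x hx, h1 x hx⟩)] at h2
    omega

theorem fold_bit (r i : Nat) : ∀ (Hs : List Nat) (a : Nat),
    (Hs.foldr (fun h b => b ||| (1 <<< (h * r % 266))) a).testBit i = true ↔
      a.testBit i = true ∨ ∃ h ∈ Hs, h * r % 266 = i := by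
  intro Hs a
  induction Hs with
  | nil => simp
  | cons h t ih =>
    rw [List.foldr_cons, Nat.testBit_or, Bool.or_eq_true, ih, Nat.one_shiftLeft,
      Nat.testBit_two_pow, decide_eq_true_iff]
    constructor
    · rintro ((h1 | ⟨g, hg, h1⟩) | h1)
      · exact Or.inl h1
      · exact Or.inr ⟨g, List.mem_cons_of_mem _ hg, h1⟩
      · exact Or.inr ⟨h, List.mem_cons_self, h1⟩
    · rintro (h1 | ⟨g, hg, h1⟩)
      · exact Or.inl (Or.inl h1)
      · rcases List.mem_cons.1 hg with rfl | hg
        · exact Or.inr h1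
        · exact Or.inl (Or.inr ⟨g, hg, h1⟩)

theorem msk_bit (i : Nat) (L : List Nat) :
    (msk L).testBit i = true ↔ ∃ r ∈ L, ∃ h ∈ H, h * r % 266 = i := by
  induction L with
  | nil => simp [msk]
  | cons r t ih =>
    have h0 : msk (r :: t) = H.foldr (fun h b => b ||| (1 <<< (h * r % 266))) (msk t) := by
      unfold msk; rw [List.foldr_cons]
    rw [h0, fold_bit, ih]
    constructor
    · rintro (⟨s, hs, h1⟩ | h1)
      · exact ⟨s, List.mem_cons_of_mem _ hs, h1⟩
      · exact ⟨r, List.mem_cons_self, h1⟩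
    · rintro ⟨s, hs, h1⟩
      rcases List.mem_cons.1 hs with rfl | hs
      · exact Or.inr h1
      · exact Or.inl ⟨s, hs, h1⟩

theorem msk_big (L : List Nat) (i : Nat) (hi : 266 ≤ i) : (msk L).testBit i = false := by
  rw [Bool.eq_false_iff]
  intro h
  obtain ⟨r, -, g, -, h1⟩ := (msk_bit i L).1 h
  have := Nat.mod_lt (g * r) (show 266 > 0 by norm_num)
  omega

def redL (L : List Nat) (w : ZMod 266) : Prop :=
  ∃ r ∈ L, ∃ h ∈ H, w = (h : ZMod 266) * (r : ZMod 266)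

theorem red_iff (L : List Nat) (w : ZMod 266) : redL L w ↔ (msk L).testBit w.val = true := by
  rw [msk_bit]
  unfold redL
  constructor
  · rintro ⟨r, hr, h, hh, rfl⟩
    refine ⟨r, hr, h, hh, ?_⟩
    rw [← Nat.cast_mul, ZMod.val_natCast]
  · rintro ⟨r, hr, h, hh, h1⟩
    refine ⟨r, hr, h, hh, ?_⟩
    rw [← Nat.cast_mul, ← ZMod.natCast_zmod_val w, ← h1, ZMod.natCast_mod]

theorem dbl_bit (L : List Nat) (j : Nat) (hj : j < 532) :
    (dbl (msk L)).testBit j = (msk L).testBit (j % 266) := by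
  unfold dbl
  rw [Nat.testBit_or, Nat.testBit_shiftLeft]
  by_cases h : j < 266
  · have h1 : ¬ (j ≥ 266) := by omega
    rw [decide_eq_false h1, Bool.false_and, Bool.or_false, Nat.mod_eq_of_lt h]
  · have h1 : j ≥ 266 := by omega
    rw [decide_eq_true h1, Bool.true_and, msk_big L j h1, Bool.false_or]
    have e : j - 266 = j % 266 := by omega
    rw [e]

theorem val_sub (x y : ZMod 266) : (x - y).val = (x.val + (266 - y.val)) % 266 := by
  have hy : y.val < 266 := ZMod.val_lt y
  have h : x - y = ((x.val + (266 - y.val) : Nat) : ZMod 266) := by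
    rw [Nat.cast_add, Nat.cast_sub hy.le, ZMod.natCast_zmod_val, ZMod.natCast_zmod_val,
      ZMod.natCast_self, zero_sub, sub_eq_add_neg]
  rw [h, ZMod.val_natCast]

theorem dbl_red (L : List Nat) (x y : ZMod 266) (h : ¬ redL L (x - y)) :
    (dbl (msk L)).testBit (x.val + (266 - y.val)) = false := by
  have hx : x.val < 266 := ZMod.val_lt x
  by_cases hy : y.val = 0
  · rw [dbl_bit _ _ (by omega), ← val_sub]
    rw [red_iff] at h
    simpa using h
  · rw [dbl_bit _ _ (by omega), ← val_sub]
    rw [red_iff] at h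
    simpa using h

theorem adj_red (L : List Nat) (x y : ZMod 266) (h : ¬ redL L (x - y)) :
    adj (dd (msk L)) x.val y.val = false := by
  have h1 := dbl_red L x y h
  have hx : x.val < 266 := ZMod.val_lt x
  have hy : y.val < 266 := ZMod.val_lt y
  unfold adj dd
  rw [Nat.testBit_shiftRight, ← Nat.shiftLeft_eq, Nat.testBit_shiftLeft, Nat.testBit_or,
    Nat.testBit_shiftLeft, Nat.testBit_two_pow_sub_one]
  have e : 862 + (330 + x.val) - (330 + y.val) - 596 = x.val + (266 - y.val) := by omega
  have e2 : ¬ (862 + (330 + x.val) - (330 + y.val) < 596) := by omega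
  rw [e, h1, decide_eq_false e2, Bool.and_false, Bool.or_false, Bool.and_false]

theorem cand_red (L : List Nat) (x a e : ZMod 266) (hxa : x ≠ a) (hxe : x ≠ e)
    (h1 : ¬ redL L (x - a)) (h2 : ¬ redL L (x - e)) :
    (cand (msk L) a.val e.val).testBit (330 + x.val) = true := by
  have g1 := dbl_red L x a h1
  have g2 := dbl_red L x e h2
  have hx : x.val < 266 := ZMod.val_lt x
  have n1 : ¬ (a.val = x.val) := fun h => hxa (ZMod.val_injective 266 h).symm
  have n2 : ¬ (e.val = x.val) := fun h => hxe (ZMod.val_injective 266 h).symm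
  have e0 : 330 + x.val - 330 = x.val := by omega
  have e1 : 330 + x.val ≥ 330 := by omega
  unfold cand full
  rw [Nat.testBit_shiftLeft, e0, decide_eq_true e1, Nat.testBit_xor, Nat.testBit_and,
    Nat.testBit_or, Nat.testBit_or, Nat.testBit_or, Nat.testBit_shiftRight,
    Nat.testBit_shiftRight, Nat.one_shiftLeft, Nat.one_shiftLeft, Nat.testBit_two_pow,
    Nat.testBit_two_pow, Nat.testBit_two_pow_sub_one, Nat.add_comm (266 - a.val),
    Nat.add_comm (266 - e.val), g1, g2, decide_eq_false n1, decide_eq_false n2,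
    decide_eq_true hx]
  rfl

theorem H_inv : ∀ h ∈ H, ∃ g ∈ H, (g : ZMod 266) * (h : ZMod 266) = 1 := by decide +kernel

theorem H_mul : ∀ g ∈ H, ∀ h ∈ H, ∃ j ∈ H,
    (g : ZMod 266) * (h : ZMod 266) = (j : ZMod 266) := by decide +kernel

theorem red_mul (L : List Nat) (w : ZMod 266) (g : Nat) (hg : g ∈ H) (h : redL L w) :
    redL L ((g : ZMod 266) * w) := by
  obtain ⟨r, hr, h, hh, rfl⟩ := h
  obtain ⟨j, hj, e⟩ := H_mul g hg h hh
  exact ⟨r, hr, j, hj, by rw [← mul_assoc, e]⟩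

theorem red_neg (L : List Nat) (w : ZMod 266) (h : redL L w) : redL L (-w) := by
  have h1 := red_mul L w 265 (by decide) h
  have h2 : ((265 : Nat) : ZMod 266) = -1 := by decide +kernel
  rwa [h2, neg_one_mul] at h1

def IndL (L : List Nat) (S : Finset (ZMod 266)) : Prop :=
  ∀ x ∈ S, ∀ y ∈ S, x ≠ y → ¬ redL L (x - y)

def nos (k : Nat) (L : List Nat) : Prop := ∀ S : Finset (ZMod 266), IndL L S → S.card ≠ k

theorem step (k : Nat) (L : List Nat) (d a : Nat) (ha : a < 266) (hc : chk1 k L d a = true)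
    (hn : nos (k + 2) (d :: L)) : nos (k + 2) L := by
  intro S hS hcard
  refine hn S ?_ hcard
  intro x hx y hy hxy hred
  have hL := hS x hx y hy hxy
  obtain ⟨r, hr, h, hh, e⟩ := hred
  rcases List.mem_cons.1 hr with rfl | hr
  swap
  · exact hL ⟨r, hr, h, hh, e⟩
  obtain ⟨g, hg, hgh⟩ := H_inv h hh
  set f : ZMod 266 → ZMod 266 := fun z => (g : ZMod 266) * (z - y) + (a : ZMod 266) with hf
  have hsub : ∀ z w, f z - f w = (g : ZMod 266) * (z - w) := by
    intro z w; simp only [hf]; ring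
  have hback : ∀ z w, (h : ZMod 266) * (f z - f w) = z - w := by
    intro z w
    rw [hsub, ← mul_assoc, mul_comm (h : ZMod 266), hgh, one_mul]
  have hinj : Function.Injective f := by
    intro z w hzw
    have := hback z w
    rw [hzw, sub_self, mul_zero] at this
    exact (sub_eq_zero.1 this.symm)
  have fy : f y = (a : ZMod 266) := by simp [hf]
  have fx : f x = ((r + a : Nat) : ZMod 266) := by
    simp only [hf]; rw [e, ← mul_assoc, hgh, one_mul, Nat.cast_add]
  have hI : IndL L (S.image f) := by
    intro z hz w hw hzw hr
    obtain ⟨z, mz, rfl⟩ := Finset.mem_image.1 hz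
    obtain ⟨w, mw, rfl⟩ := Finset.mem_image.1 hw
    have := red_mul L _ h hh hr
    rw [hback] at this
    exact hS z mz w mw (fun h => hzw (by rw [h])) this
  have hfx : f x ∈ S.image f := Finset.mem_image_of_mem f hx
  have hfy : f y ∈ S.image f := Finset.mem_image_of_mem f hy
  have hfxy : f x ≠ f y := fun h => hxy (hinj h)
  have va : (f y).val = a := by rw [fy, ZMod.val_natCast, Nat.mod_eq_of_lt ha]
  have ve : (f x).val = (r + a) % 266 := by rw [fx, ZMod.val_natCast]
  unfold chk1 at hc
  rw [force_eq, force_eq, force_eq, force_eq, ← ve] at hc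
  have hc2 : srch (2 ^ 330) (dd (msk L)) k (cand (msk L) (f y).val (f x).val) = true := by
    rw [va]; exact hc
  refine srch_spec _ k _ hc2 ((((S.image f).erase (f y)).erase (f x)).image ZMod.val) ?_ ?_ ?_
  · intro u hu v hv huv
    obtain ⟨u, mu, rfl⟩ := Finset.mem_image.1 hu
    obtain ⟨v, mv, rfl⟩ := Finset.mem_image.1 hv
    refine adj_red L u v (hI u ?_ v ?_ (fun h => huv (by rw [h])))
    · exact Finset.mem_of_mem_erase (Finset.mem_of_mem_erase mu)
    · exact Finset.mem_of_mem_erase (Finset.mem_of_mem_erase mv)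
  · intro u hu
    obtain ⟨u, mu, rfl⟩ := Finset.mem_image.1 hu
    have h1 := Finset.ne_of_mem_erase mu
    have h2 := Finset.ne_of_mem_erase (Finset.mem_of_mem_erase mu)
    have h3 := Finset.mem_of_mem_erase (Finset.mem_of_mem_erase mu)
    exact cand_red L u (f y) (f x) h2 h1 (hI u h3 _ hfy h2) (hI u h3 _ hfx h1)
  · rw [Finset.card_image_of_injective _ (ZMod.val_injective 266),
      Finset.card_erase_of_mem (Finset.mem_erase.2 ⟨hfxy, hfx⟩),
      Finset.card_erase_of_mem hfy, Finset.card_image_of_injective _ hinj, hcard]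
    rfl

theorem base (k : Nat) (L : List Nat) (h : msk L ||| 1 = full) : nos (k + 2) L := by
  intro S hS hc
  obtain ⟨x, hx, y, hy, hxy⟩ := Finset.one_lt_card.1 (show 1 < S.card by omega)
  refine hS x hx y hy hxy ((red_iff _ _).2 ?_)
  have hv : (x - y).val < 266 := ZMod.val_lt _
  have h0 : (x - y).val ≠ 0 := fun h => (sub_ne_zero.2 hxy) ((ZMod.val_eq_zero _).1 h)
  have h1 := congrArg (fun z => z.testBit (x - y).val) h
  unfold full at h1
  simp only [Nat.testBit_or] at h1
  rw [Nat.testBit_two_pow_sub_one, decide_eq_true hv] at h1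
  have h2 : Nat.testBit 1 (x - y).val = false := by
    rw [Bool.eq_false_iff]; intro h3; exact h0 (Nat.testBit_one_eq_true_iff_self_eq_zero.1 h3)
  rw [h2, Bool.or_false] at h1
  exact h1

/-- run through a list of elimination steps -/
def chk (k : Nat) : List (Nat × Nat) → List Nat → Bool
  | [], L => Nat.beq (msk L ||| 1) full
  | (d, a) :: t, L => Nat.blt a 266 && (chk1 k L d a && chk k t (d :: L))

theorem chk_spec (k : Nat) : ∀ (o : List (Nat × Nat)) (L : List Nat), chk k o L = true →
    nos (k + 2) L := by
  intro o
  induction o with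
  | nil => intro L h; unfold chk at h; exact base k L (Nat.eq_of_beq_eq_true h)
  | cons p t ih =>
    obtain ⟨d, a⟩ := p
    intro L h
    unfold chk at h
    rw [Bool.and_eq_true, Bool.and_eq_true] at h
    exact step k L d a (by simpa [Nat.blt_eq] using h.1) h.2.1 (ih _ h.2.2)

theorem big0 : chk1 12 reds 77 147 = true := by decide +kernel

theorem big1 : chk1 12 (77 :: reds) 29 162 = true := by decide +kernel

theorem big2 : chk1 12 (29 :: 77 :: reds) 14 188 = true := by decide +kernel

theorem big3 : chk1 12 (14 :: 29 :: 77 :: reds) 197 254 = true := by decide +kernel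

theorem big4 : chk1 12 (197 :: 14 :: 29 :: 77 :: reds) 27 164 = true := by decide +kernel

theorem big5 : chk1 12 (27 :: 197 :: 14 :: 29 :: 77 :: reds) 80 66 = true := by decide +kernel

theorem big6 : chk1 12 (80 :: 27 :: 197 :: 14 :: 29 :: 77 :: reds) 6 222 = true := by decide +kernel

theorem big7 : chk1 12 (6 :: 80 :: 27 :: 197 :: 14 :: 29 :: 77 :: reds) 211 207 = true := by decide +kernel

theorem tail : chk 12 [(59, 165), (1, 101), (65, 165), (98, 120), (120, 2), (42, 0), (22, 0), (202, 0), (183, 0), (150, 0), (126, 0), (36, 0), (3, 0), (84, 0), (30, 0), (13, 0), (51, 0), (56, 0), (18, 0), (15, 0), (23, 0), (10, 0), (66, 0), (33, 0), (119, 0), (38, 0)] (211 :: 6 :: 80 :: 27 :: 197 :: 14 :: 29 :: 77 :: reds) = true := by decide +kernel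

theorem nos14 : nos 14 reds :=
  step 12 _ 77 147 (by norm_num) big0 <|
  step 12 _ 29 162 (by norm_num) big1 <|
  step 12 _ 14 188 (by norm_num) big2 <|
  step 12 _ 197 254 (by norm_num) big3 <|
  step 12 _ 27 164 (by norm_num) big4 <|
  step 12 _ 80 66 (by norm_num) big5 <|
  step 12 _ 6 222 (by norm_num) big6 <|
  step 12 _ 211 207 (by norm_num) big7 <|
  chk_spec 12 _ _ tail

def blues : List Nat :=
  [77, 29, 14, 197, 27, 80, 6, 211, 59, 1, 65, 98, 120, 42, 22, 202, 183, 150, 126, 36, 3,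
   84, 30, 13, 51, 56, 18, 15, 23, 10, 66, 33, 119, 38]

theorem chk5 : chk 3 (reds.map fun d => (d, 0)) blues = true := by decide +kernel

theorem disj : msk reds &&& msk blues = 0 := by decide +kernel

theorem clique5 (S : Finset (ZMod 266)) (h : ∀ x ∈ S, ∀ y ∈ S, x ≠ y → redL reds (x - y)) :
    S.card ≠ 5 := by
  refine chk_spec 3 _ _ chk5 S ?_
  intro x hx y hy hxy hb
  have h1 := (red_iff _ _).1 (h x hx y hy hxy)
  have h2 := (red_iff _ _).1 hb
  have h3 := congrArg (fun z => z.testBit (x - y).val) disj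
  simp only [Nat.testBit_and, h1, h2] at h3
  simp at h3

def G : SimpleGraph (Fin 268) where
  Adj i j := i ≠ j ∧ ((i.val < 266 ∧ j.val < 266 ∧
    redL reds ((i.val : ZMod 266) - (j.val : ZMod 266))) ∨ (266 ≤ i.val ∧ 266 ≤ j.val))
  symm := by
    constructor
    rintro i j ⟨h, h1 | h1⟩
    · refine ⟨h.symm, Or.inl ⟨h1.2.1, h1.1, ?_⟩⟩
      have := red_neg _ _ h1.2.2
      rwa [neg_sub] at this
    · exact ⟨h.symm, Or.inr ⟨h1.2, h1.1⟩⟩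
  loopless := ⟨fun i h => h.1 rfl⟩

theorem cast_inj (i j : Fin 268) (hi : i.val < 266) (hj : j.val < 266)
    (h : (i.val : ZMod 266) = (j.val : ZMod 266)) : i = j := by
  have h1 := congrArg ZMod.val h
  rw [ZMod.val_natCast, ZMod.val_natCast, Nat.mod_eq_of_lt hi, Nat.mod_eq_of_lt hj] at h1
  exact Fin.ext h1

theorem cast_card (S : Finset (Fin 268)) (h : ∀ i ∈ S, i.val < 266) :
    (S.image (fun i : Fin 268 => (i.val : ZMod 266))).card = S.card := by
  apply Finset.card_image_of_injOn
  intro i hi j hj hij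
  exact cast_inj i j (h i hi) (h j hj) hij

theorem G_free : G.CliqueFree 5 := by
  intro S hS
  have hc := hS.card_eq
  have hq : ∀ i ∈ S, ∀ j ∈ S, i ≠ j → G.Adj i j := fun i hi j hj hij => hS.isClique hi hj hij
  by_cases hbig : ∃ i ∈ S, 266 ≤ i.val
  · obtain ⟨i, hi, hi2⟩ := hbig
    have hsub : S ⊆ {(266 : Fin 268), (267 : Fin 268)} := by
      intro j hj
      have hj2 : 266 ≤ j.val := by
        by_cases hij : i = j
        · rw [← hij]; exact hi2
        · rcases (hq i hi j hj hij).2 with h | h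
          · omega
          · exact h.2
      have hj3 : j.val = 266 ∨ j.val = 267 := by omega
      rw [Finset.mem_insert, Finset.mem_singleton]
      rcases hj3 with h | h
      · exact Or.inl (Fin.ext h)
      · exact Or.inr (Fin.ext h)
    have h1 := Finset.card_le_card hsub
    have h2 := Finset.card_le_two (a := (266 : Fin 268)) (b := 267)
    omega
  · push Not at hbig
    refine clique5 (S.image (fun i : Fin 268 => (i.val : ZMod 266))) ?_
      ((cast_card S hbig).trans hc)
    intro x hx y hy hxy
    obtain ⟨i, mi, rfl⟩ := Finset.mem_image.1 hx
    obtain ⟨j, mj, rfl⟩ := Finset.mem_image.1 hy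
    have hij : i ≠ j := fun h => hxy (by rw [h])
    rcases (hq i mi j mj hij).2 with h | h
    · exact h.2.2
    · have := hbig i mi
      omega

theorem G_compl_free : Gᶜ.CliqueFree 15 := by
  intro S hS
  have hc := hS.card_eq
  have hq : ∀ i ∈ S, ∀ j ∈ S, i ≠ j → ¬ G.Adj i j := fun i hi j hj hij =>
    ((SimpleGraph.compl_adj _ _ _).1 (hS.isClique hi hj hij)).2
  have h1 : (S.filter (fun i => ¬ (i.val < 266))).card ≤ 1 := by
    rw [Finset.card_le_one]
    intro i hi j hj
    rw [Finset.mem_filter] at hi hj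
    by_contra hij
    exact hq i hi.1 j hj.1 hij ⟨hij, Or.inr ⟨by omega, by omega⟩⟩
  have h2 := Finset.card_filter_add_card_filter_not (s := S) (fun i : Fin 268 => i.val < 266)
  have h3 : 14 ≤ (S.filter (fun i => i.val < 266)).card := by omega
  obtain ⟨U, hU, hUc⟩ := Finset.exists_subset_card_eq h3
  have hlt : ∀ i ∈ U, i.val < 266 := fun i hi => (Finset.mem_filter.1 (hU hi)).2
  refine nos14 (U.image (fun i : Fin 268 => (i.val : ZMod 266))) ?_
    ((cast_card U hlt).trans hUc)
  intro x hx y hy hxy hr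
  obtain ⟨i, mi, rfl⟩ := Finset.mem_image.1 hx
  obtain ⟨j, mj, rfl⟩ := Finset.mem_image.1 hy
  have hij : i ≠ j := fun h => hxy (by rw [h])
  exact hq i (Finset.mem_filter.1 (hU mi)).1 j (Finset.mem_filter.1 (hU mj)).1 hij
    ⟨hij, Or.inl ⟨hlt i mi, hlt j mj, hr⟩⟩

end R515

theorem ramsey_lower_bound_R_5_15 :
    ∃ G : SimpleGraph (Fin 268), G.CliqueFree 5 ∧ Gᶜ.CliqueFree 15 := by
  exact ⟨R515.G, R515.G_free, R515.G_compl_free⟩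
end

section
/- R(6,7) ≥ 115; that is, there exists a 2-coloring of the edges of the complete graph K_114 containing no monochromatic K_6 in color 1 and no monochromatic K_7 in color 2. -/
/-! We exhibit an explicit graph on 114 vertices (found by local search starting from the Paley
graph on 101 vertices plus 13 additional vertices) and check, with a verified clique search
running inside the kernel on bitmasks, that it has no 6-clique and no independent 7-set. -/

namespace RamseySixSeven

/-- Search trees holding the rows of the adjacency matrix. A leaf for the vertex `v` holds `2 ^ v`
and row `v`; an inner node holds a threshold. -/
inductive Tree : Type where
  | leaf : Nat → Nat → Tree
  | node : Nat → Tree → Tree → Tree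

/-- Find the leaf for the highest bit of `c` and hand its data to `k`. -/
noncomputable def Tree.get (k : Nat → Nat → Bool) (c : Nat) (t : Tree) : Bool :=
  Tree.rec (motive := fun _ => Bool) (fun p r => k p r)
    (fun m _ _ ihl ihr => Bool.rec (motive := fun _ => Bool) ihl ihr (Nat.ble m c)) t

/-- The same search, returning the leaf. -/
def Tree.find (c : Nat) : Tree → Nat × Nat
  | .leaf p r => (p, r)
  | .node m a b => if m ≤ c then b.find c else a.find c

/-- All thresholds are powers of two. -/
def Tree.pows : Tree → Bool
  | .leaf _ _ => true
  | .node m a b => m == 2 ^ m.log2 && a.pows && b.pows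

/-- Lower triangle of the adjacency matrix: in the row of `v`, bit `u` (`u < v`) says that `v` and
`u` are adjacent. -/
def rows : Tree :=
  (.node (nat_lit 144115188075855872)
   (.node (nat_lit 268435456)
    (.node (nat_lit 16384)
     (.node (nat_lit 128)
      (.node (nat_lit 8)
       (.node (nat_lit 2)
        (.leaf (nat_lit 1)
         (nat_lit 0))
        (.node (nat_lit 4)
         (.leaf (nat_lit 2)
          (nat_lit 1))
         (.leaf (nat_lit 4)
          (nat_lit 2))))
       (.node (nat_lit 32)
        (.node (nat_lit 16)
         (.leaf (nat_lit 8)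
          (nat_lit 4))
         (.leaf (nat_lit 16)
          (nat_lit 9)))
        (.node (nat_lit 64)
         (.leaf (nat_lit 32)
          (nat_lit 19))
         (.leaf (nat_lit 64)
          (nat_lit 39)))))
      (.node (nat_lit 1024)
       (.node (nat_lit 256)
        (.leaf (nat_lit 128)
         (nat_lit 78))
        (.node (nat_lit 512)
         (.leaf (nat_lit 256)
          (nat_lit 28))
         (.leaf (nat_lit 512)
          (nat_lit 313))))
       (.node (nat_lit 4096)
        (.node (nat_lit 2048)
         (.leaf (nat_lit 1024)
          (nat_lit 626))
         (.leaf (nat_lit 2048)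
          (nat_lit 1252)))
        (.node (nat_lit 8192)
         (.leaf (nat_lit 4096)
          (nat_lit 2504))
         (.leaf (nat_lit 8192)
          (nat_lit 5009))))))
     (.node (nat_lit 2097152)
      (.node (nat_lit 131072)
       (.node (nat_lit 32768)
        (.leaf (nat_lit 16384)
         (nat_lit 10019))
        (.node (nat_lit 65536)
         (.leaf (nat_lit 32768)
          (nat_lit 20038))
         (.leaf (nat_lit 65536)
          (nat_lit 40077))))
       (.node (nat_lit 524288)
        (.node (nat_lit 262144)
         (.leaf (nat_lit 131072)
          (nat_lit 80155))
         (.leaf (nat_lit 262144)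
          (nat_lit 160310)))
        (.node (nat_lit 1048576)
         (.leaf (nat_lit 524288)
          (nat_lit 320621))
         (.leaf (nat_lit 1048576)
          (nat_lit 641243)))))
      (.node (nat_lit 16777216)
       (.node (nat_lit 4194304)
        (.leaf (nat_lit 2097152)
         (nat_lit 1282487))
        (.node (nat_lit 8388608)
         (.leaf (nat_lit 4194304)
          (nat_lit 2564975))
         (.leaf (nat_lit 8388608)
          (nat_lit 5129951))))
       (.node (nat_lit 67108864)
        (.node (nat_lit 33554432)
         (.leaf (nat_lit 16777216)
          (nat_lit 10259647))
         (.leaf (nat_lit 33554432)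
          (nat_lit 20519807)))
        (.node (nat_lit 134217728)
         (.leaf (nat_lit 67108864)
          (nat_lit 41039614))
         (.leaf (nat_lit 134217728)
          (nat_lit 82079228)))))))
    (.node (nat_lit 4398046511104)
     (.node (nat_lit 34359738368)
      (.node (nat_lit 2147483648)
       (.node (nat_lit 536870912)
        (.leaf (nat_lit 268435456)
         (nat_lit 164158456))
        (.node (nat_lit 1073741824)
         (.leaf (nat_lit 536870912)
          (nat_lit 328316912))
         (.leaf (nat_lit 1073741824)
          (nat_lit 656633825))))
       (.node (nat_lit 8589934592)
        (.node (nat_lit 4294967296)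
         (.leaf (nat_lit 2147483648)
          (nat_lit 1313267651))
         (.leaf (nat_lit 4294967296)
          (nat_lit 2626535302)))
        (.node (nat_lit 17179869184)
         (.leaf (nat_lit 8589934592)
          (nat_lit 5253070605))
         (.leaf (nat_lit 17179869184)
          (nat_lit 13479436710)))))
      (.node (nat_lit 274877906944)
       (.node (nat_lit 68719476736)
        (.leaf (nat_lit 34359738368)
         (nat_lit 3832413236))
        (.node (nat_lit 137438953472)
         (.leaf (nat_lit 68719476736)
          (nat_lit 42024564841))
         (.leaf (nat_lit 137438953472)
          (nat_lit 101228998867))))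
       (.node (nat_lit 1099511627776)
        (.node (nat_lit 549755813888)
         (.leaf (nat_lit 274877906944)
          (nat_lit 150917996966))
         (.leaf (nat_lit 549755813888)
          (nat_lit 336196518732)))
        (.node (nat_lit 2199023255552)
         (.leaf (nat_lit 1099511627776)
          (nat_lit 655213168280))
         (.leaf (nat_lit 2199023255552)
          (nat_lit 1344786074928))))))
     (.node (nat_lit 562949953421312)
      (.node (nat_lit 35184372088832)
       (.node (nat_lit 8796093022208)
        (.leaf (nat_lit 4398046511104)
         (nat_lit 2706752019040))
        (.node (nat_lit 17592186044416)
         (.leaf (nat_lit 8796093022208)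
          (nat_lit 5379144299713))
         (.leaf (nat_lit 17592186044416)
          (nat_lit 10775468468610))))
       (.node (nat_lit 140737488355328)
        (.node (nat_lit 70368744177664)
         (.leaf (nat_lit 35184372088832)
          (nat_lit 21516577198853))
         (.leaf (nat_lit 70368744177664)
          (nat_lit 43033154397706)))
        (.node (nat_lit 281474976710656)
         (.leaf (nat_lit 140737488355328)
          (nat_lit 86066308795413))
         (.leaf (nat_lit 281474976710656)
          (nat_lit 172115437721642)))))
      (.node (nat_lit 9007199254740992)
       (.node (nat_lit 2251799813685248)
        (.node (nat_lit 1125899906842624)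
         (.leaf (nat_lit 562949953421312)
          (nat_lit 344265235181653))
         (.leaf (nat_lit 1125899906842624)
          (nat_lit 688513290494122)))
        (.node (nat_lit 4503599627370496)
         (.leaf (nat_lit 2251799813685248)
          (nat_lit 1377060940726612))
         (.leaf (nat_lit 4503599627370496)
          (nat_lit 2754139061322409))))
       (.node (nat_lit 36028797018963968)
        (.node (nat_lit 18014398509481984)
         (.leaf (nat_lit 9007199254740992)
          (nat_lit 5508226583037266))
         (.leaf (nat_lit 18014398509481984)
          (nat_lit 11016487525812901)))
        (.node (nat_lit 72057594037927936)
         (.leaf (nat_lit 36028797018963968)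
          (nat_lit 4018557214790720))
         (.leaf (nat_lit 72057594037927936)
          (nat_lit 8037135904418453))))))))
   (.node (nat_lit 38685626227668133590597632)
    (.node (nat_lit 2361183241434822606848)
     (.node (nat_lit 18446744073709551616)
      (.node (nat_lit 1152921504606846976)
       (.node (nat_lit 288230376151711744)
        (.leaf (nat_lit 144115188075855872)
         (nat_lit 88131625328596266))
        (.node (nat_lit 576460752303423488)
         (.leaf (nat_lit 288230376151711744)
          (nat_lit 176263525535099477))
         (.leaf (nat_lit 576460752303423488)
          (nat_lit 352527600826012842))))
       (.node (nat_lit 4611686018427387904)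
        (.node (nat_lit 2305843009213693952)
         (.leaf (nat_lit 1152921504606846976)
          (nat_lit 705055218831894868))
         (.leaf (nat_lit 2305843009213693952)
          (nat_lit 1410110420483920552)))
        (.node (nat_lit 9223372036854775808)
         (.leaf (nat_lit 4611686018427387904)
          (nat_lit 2820220823787971920))
         (.leaf (nat_lit 9223372036854775808)
          (nat_lit 5640441630396074656)))))
      (.node (nat_lit 147573952589676412928)
       (.node (nat_lit 36893488147419103232)
        (.leaf (nat_lit 18446744073709551616)
         (nat_lit 11280883209252541761))
        (.node (nat_lit 73786976294838206464)
         (.leaf (nat_lit 36893488147419103232)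
          (nat_lit 22561766435684952707))
         (.leaf (nat_lit 73786976294838206464)
          (nat_lit 46508679212489048970))))
       (.node (nat_lit 590295810358705651712)
        (.node (nat_lit 295147905179352825856)
         (.leaf (nat_lit 147573952589676412928)
          (nat_lit 16460089499441211916))
         (.leaf (nat_lit 295147905179352825856)
          (nat_lit 254281107660058743833)))
        (.node (nat_lit 1180591620717411303424)
         (.leaf (nat_lit 590295810358705651712)
          (nat_lit 360988263263017019442))
         (.leaf (nat_lit 1180591620717411303424)
          (nat_lit 648189550179656224869))))))
     (.node (nat_lit 302231454903657293676544)
      (.node (nat_lit 18889465931478580854784)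
       (.node (nat_lit 4722366482869645213696)
        (.leaf (nat_lit 2361183241434822606848)
         (nat_lit 1439341364765876977739))
        (.node (nat_lit 9444732965739290427392)
         (.leaf (nat_lit 4722366482869645213696)
          (nat_lit 452935888237036388758))
         (.leaf (nat_lit 9444732965739290427392)
          (nat_lit 5775812211933394404140))))
       (.node (nat_lit 75557863725914323419136)
        (.node (nat_lit 37778931862957161709568)
         (.leaf (nat_lit 18889465931478580854784)
          (nat_lit 11551624423883968677464))
         (.leaf (nat_lit 37778931862957161709568)
          (nat_lit 23029461871181041372336)))
        (.node (nat_lit 151115727451828646838272)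
         (.leaf (nat_lit 75557863725914323419136)
          (nat_lit 46206497695467155233121))
         (.leaf (nat_lit 151115727451828646838272)
          (nat_lit 92412995390917130597059)))))
      (.node (nat_lit 2417851639229258349412352)
       (.node (nat_lit 604462909807314587353088)
        (.leaf (nat_lit 302231454903657293676544)
         (nat_lit 184899741729366440174983))
        (.node (nat_lit 1208925819614629174706176)
         (.leaf (nat_lit 604462909807314587353088)
          (nat_lit 369578194587425223789327))
         (.leaf (nat_lit 1208925819614629174706176)
          (nat_lit 739230176151179645523487))))
       (.node (nat_lit 9671406556917033397649408)
        (.node (nat_lit 4835703278458516698824704)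
         (.leaf (nat_lit 2417851639229258349412352)
          (nat_lit 1478681713231243805666367))
         (.leaf (nat_lit 4835703278458516698824704)
          (nat_lit 2957142065533603096713343)))
        (.node (nat_lit 19342813113834066795298816)
         (.leaf (nat_lit 9671406556917033397649408)
          (nat_lit 5914357918043226153726206))
         (.leaf (nat_lit 19342813113834066795298816)
          (nat_lit 11826502226798156917072381)))))))
    (.node (nat_lit 633825300114114700748351602688)
     (.node (nat_lit 4951760157141521099596496896)
      (.node (nat_lit 309485009821345068724781056)
       (.node (nat_lit 77371252455336267181195264)
        (.leaf (nat_lit 38685626227668133590597632)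
         (nat_lit 23657653033102905821021179))
        (.node (nat_lit 154742504910672534362390528)
         (.leaf (nat_lit 77371252455336267181195264)
          (nat_lit 47315453604129552759883766))
         (.leaf (nat_lit 154742504910672534362390528)
          (nat_lit 94628472310099021436489709))))
       (.node (nat_lit 1237940039285380274899124224)
        (.node (nat_lit 618970019642690137449562112)
         (.leaf (nat_lit 309485009821345068724781056)
          (nat_lit 189261814524604928513941339))
         (.leaf (nat_lit 618970019642690137449562112)
          (nat_lit 378523555334290640831528886)))
        (.node (nat_lit 2475880078570760549798248448)
         (.leaf (nat_lit 1237940039285380274899124224)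
          (nat_lit 757047258242533871339470700))
         (.leaf (nat_lit 2475880078570760549798248448)
          (nat_lit 1514094516449038945659977432)))))
      (.node (nat_lit 39614081257132168796771975168)
       (.node (nat_lit 9903520314283042199192993792)
        (.leaf (nat_lit 4951760157141521099596496896)
         (nat_lit 3028186671786893775657368753))
        (.node (nat_lit 19807040628566084398385987584)
         (.leaf (nat_lit 9903520314283042199192993792)
          (nat_lit 6056378065940270970715765602))
         (.leaf (nat_lit 19807040628566084398385987584)
          (nat_lit 12112756131880541958611400388))))
       (.node (nat_lit 158456325028528675187087900672)
        (.node (nat_lit 79228162514264337593543950336)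
         (.leaf (nat_lit 39614081257132168796771975168)
          (nat_lit 12931709421004125182370119089))
         (.leaf (nat_lit 79228162514264337593543950336)
          (nat_lit 48451024527522167782905994003)))
        (.node (nat_lit 316912650057057350374175801344)
         (.leaf (nat_lit 158456325028528675187087900672)
          (nat_lit 136516130312176504328224224807))
         (.leaf (nat_lit 316912650057057350374175801344)
          (nat_lit 233418179367220839842496605262))))))
     (.node (nat_lit 81129638414606681695789005144064)
      (.node (nat_lit 5070602400912917605986812821504)
       (.node (nat_lit 1267650600228229401496703205376)
        (.leaf (nat_lit 633825300114114700748351602688)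
         (nat_lit 347994114889258197017018947740))
        (.node (nat_lit 2535301200456458802993406410752)
         (.leaf (nat_lit 1267650600228229401496703205376)
          (nat_lit 735602311183222515454846021945))
         (.leaf (nat_lit 2535301200456458802993406410752)
          (nat_lit 5261247602041170563916890368))))
       (.node (nat_lit 20282409603651670423947251286016)
        (.node (nat_lit 10141204801825835211973625643008)
         (.leaf (nat_lit 5070602400912917605986812821504)
          (nat_lit 3237204029583507366461234559310))
         (.leaf (nat_lit 10141204801825835211973625643008)
          (nat_lit 228589199062713294169543417819)))
        (.node (nat_lit 40564819207303340847894502572032)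
         (.leaf (nat_lit 20282409603651670423947251286016)
          (nat_lit 19080066775461569519459348811071))
         (.leaf (nat_lit 40564819207303340847894502572032)
          (nat_lit 38678251839585924748571371242368)))))
      (.node (nat_lit 1298074214633706907132624082305024)
       (.node (nat_lit 324518553658426726783156020576256)
        (.node (nat_lit 162259276829213363391578010288128)
         (.leaf (nat_lit 81129638414606681695789005144064)
          (nat_lit 35651958926804615271510813876427))
         (.leaf (nat_lit 162259276829213363391578010288128)
          (nat_lit 125819760439991995989072470352000)))
        (.node (nat_lit 649037107316853453566312041152512)
         (.leaf (nat_lit 324518553658426726783156020576256)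
          (nat_lit 153750104948081693504942105171274))
         (.leaf (nat_lit 649037107316853453566312041152512)
          (nat_lit 416786338311328921670946194390554))))
       (.node (nat_lit 5192296858534827628530496329220096)
        (.node (nat_lit 2596148429267413814265248164610048)
         (.leaf (nat_lit 1298074214633706907132624082305024)
          (nat_lit 503393443350920264327708648043164))
         (.leaf (nat_lit 2596148429267413814265248164610048)
          (nat_lit 1568821071454850726532211801058697)))
        (.node (nat_lit 10384593717069655257060992658440192)
         (.leaf (nat_lit 5192296858534827628530496329220096)
          (nat_lit 1390221497079061581097850007868678))
         (.leaf (nat_lit 10384593717069655257060992658440192)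
          (nat_lit 235822625726142807093985125859712)))))))))

/-- Row `v` of the adjacency matrix. -/
def row (v : Nat) : Nat := (rows.find (2 ^ v)).2

/-- For every `v` in the bitmask `c` (largest first), run `g` on the part of the neighbourhood
of `v` in the remaining vertices, the neighbourhood being given by `nb` and the row. -/
noncomputable def loop (nb : Nat → Nat → Nat) (g : Nat → Bool) (f : Nat) : Nat → Bool :=
  Nat.rec (motive := fun _ => Nat → Bool) (fun c => Nat.beq c 0)
    (fun _ ih c => Nat.rec (motive := fun _ => Bool) true
      (fun d _ => rows.get (fun p r =>
        Bool.rec (motive := fun _ => Bool) false (ih (Nat.xor (Nat.succ d) p))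
          (g (nb r (Nat.xor (Nat.succ d) p)))) (Nat.succ d)) c) f

/-- `free nb k c`: no clique of size `k` inside the bitmask `c`. -/
noncomputable def free (nb : Nat → Nat → Nat) (k : Nat) : Nat → Bool :=
  Nat.rec (motive := fun _ => Nat → Bool) (fun _ => false)
    (fun _ ih c => loop nb ih (nat_lit 114) c) k

def nbRed (r c : Nat) : Nat := Nat.land c r

def nbBlue (r c : Nat) : Nat := Nat.xor c (Nat.land c r)

theorem get_eq (k : Nat → Nat → Bool) (c : Nat) (t : Tree) :
    t.get k c = k (t.find c).1 (t.find c).2 := by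
  induction t with
  | leaf p r => rfl
  | node m a b iha ihb =>
    have h : (Tree.node m a b).get k c =
        Bool.rec (motive := fun _ => Bool) (a.get k c) (b.get k c) (Nat.ble m c) := rfl
    rw [h, iha, ihb]
    by_cases hm : m ≤ c
    · rw [Nat.ble_eq_true_of_le hm]
      simp [Tree.find, hm]
    · have : Nat.ble m c = false := by
        rw [← Bool.not_eq_true]
        exact fun h => hm (Nat.le_of_ble_eq_true h)
      rw [this]
      simp [Tree.find, hm]

theorem find_log (c : Nat) (hc : c ≠ 0) (t : Tree) (ht : t.pows = true) :
    t.find c = t.find (2 ^ c.log2) := by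
  induction t with
  | leaf p r => rfl
  | node m a b iha ihb =>
    simp only [Tree.pows, Bool.and_eq_true, beq_iff_eq] at ht
    obtain ⟨⟨hm, ha⟩, hb⟩ := ht
    have : m ≤ c ↔ m ≤ 2 ^ c.log2 := by
      rw [hm, ← Nat.le_log2 hc, Nat.pow_le_pow_iff_right (by norm_num)]
    simp only [Tree.find, this, iha ha, ihb hb]

theorem rows_pows : rows.pows = true := by
  decide +kernel

theorem rows_fst : ∀ v < 114, (rows.find (2 ^ v)).1 = 2 ^ v := by
  decide +kernel

theorem loop_zero (nb : Nat → Nat → Nat) (g : Nat → Bool) (c : Nat) :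
    loop nb g 0 c = Nat.beq c 0 := rfl

theorem loop_succ (nb : Nat → Nat → Nat) (g : Nat → Bool) (f c : Nat) (hc : c ≠ 0)
    (hc2 : c < 2 ^ 114) (h : loop nb g (f + 1) c = true) :
    g (nb (row c.log2) (c ^^^ 2 ^ c.log2)) = true ∧ loop nb g f (c ^^^ 2 ^ c.log2) = true := by
  have hf := find_log c hc rows rows_pows
  have hf1 : (rows.find c).1 = 2 ^ c.log2 := by
    rw [hf]
    exact rows_fst _ ((Nat.log2_lt hc).2 hc2)
  have hf2 : (rows.find c).2 = row c.log2 := by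
    rw [hf]
    rfl
  have e : loop nb g (f + 1) c = rows.get (fun p r =>
        Bool.rec (motive := fun _ => Bool) false (loop nb g f (Nat.xor c p))
          (g (nb r (Nat.xor c p)))) c := by
    obtain ⟨d, rfl⟩ := Nat.exists_eq_succ_of_ne_zero hc
    rfl
  rw [e, get_eq, hf1, hf2] at h
  change Bool.rec (motive := fun _ => Bool) false (loop nb g f (c ^^^ 2 ^ c.log2))
          (g (nb (row c.log2) (c ^^^ 2 ^ c.log2))) = true at h
  cases hg : g (nb (row c.log2) (c ^^^ 2 ^ c.log2)) with
  | false =>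
    rw [hg] at h
    exact absurd h (by simp)
  | true =>
    rw [hg] at h
    exact ⟨rfl, h⟩

theorem loop_spec (nb : Nat → Nat → Nat) (g : Nat → Bool) (f : Nat) :
    ∀ c < 2 ^ 114, loop nb g f c = true → ∀ v, c.testBit v = true →
      ∃ c' < 2 ^ 114, g (nb (row v) c') = true ∧
        ∀ u < v, c.testBit u = true → c'.testBit u = true := by
  induction f with
  | zero =>
    intro c _ h v hv
    rw [loop_zero] at h
    have : c = 0 := Nat.eq_of_beq_eq_true h
    subst this
    simp at hv
  | succ f ih =>
    intro c hc2 h v hv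
    have hc : c ≠ 0 := by
      rintro rfl
      simp at hv
    have h := loop_succ nb g f c hc hc2 h
    have hlt : c ^^^ 2 ^ c.log2 < 2 ^ 114 :=
      Nat.xor_lt_two_pow hc2 (lt_of_le_of_lt (Nat.log2_self_le hc) hc2)
    have key : ∀ u, u ≠ c.log2 → c.testBit u = true →
        (c ^^^ 2 ^ c.log2).testBit u = true := by
      intro u hu hcu
      rw [Nat.testBit_xor, hcu, Nat.testBit_two_pow_of_ne (Ne.symm hu)]
      rfl
    have hle : v ≤ c.log2 := by
      rw [Nat.le_log2 hc]
      exact Nat.ge_two_pow_of_testBit hv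
    by_cases hvw : v = c.log2
    · refine ⟨c ^^^ 2 ^ c.log2, hlt, ?_, fun u hu hcu => key u (by omega) hcu⟩
      rw [hvw]
      exact h.1
    · obtain ⟨c', h0, h1, h2⟩ := ih _ hlt h.2 v (key v hvw hv)
      exact ⟨c', h0, h1, fun u hu hcu => h2 u hu (key u (by omega) hcu)⟩

theorem free_spec (nb : Nat → Nat → Nat) (r : Nat → Nat → Prop)
    (hnb : ∀ v u c, c.testBit u = true → r v u → (nb (row v) c).testBit u = true)
    (hlt : ∀ a c, c < 2 ^ 114 → nb a c < 2 ^ 114) (k : Nat) :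
    ∀ c < 2 ^ 114, free nb k c = true → ∀ s : Finset ℕ, s.card = k →
      (∀ v ∈ s, c.testBit v = true) → (∀ v ∈ s, ∀ u ∈ s, u < v → r v u) → False := by
  induction k with
  | zero =>
    intro c _ h
    exact absurd h (by simp [free])
  | succ k ih =>
    intro c hc2 h s hs hc hr
    have hne : s.Nonempty := by
      rw [← Finset.card_pos]
      omega
    have hm := s.max'_mem hne
    obtain ⟨c', h0, h1, h2⟩ := loop_spec nb (free nb k) 114 c hc2 h _ (hc _ hm)
    have hmax : ∀ u ∈ s.erase (s.max' hne), u < s.max' hne := fun u hu =>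
      lt_of_le_of_ne (s.le_max' u (Finset.mem_of_mem_erase hu)) (Finset.ne_of_mem_erase hu)
    refine ih _ (hlt _ _ h0) h1 (s.erase (s.max' hne)) ?_ ?_ ?_
    · rw [Finset.card_erase_of_mem hm, hs]
      rfl
    · intro u hu
      have hus := Finset.mem_of_mem_erase hu
      exact hnb _ _ _ (h2 u (hmax u hu) (hc u hus)) (hr _ hm u hus (hmax u hu))
    · intro v hv u hu
      exact hr v (Finset.mem_of_mem_erase hv) u (Finset.mem_of_mem_erase hu)

theorem check_red : free nbRed 6 (2 ^ 114 - 1) = true := by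
  decide +kernel

theorem check_blue : free nbBlue 7 (2 ^ 114 - 1) = true := by
  decide +kernel

/-- The Ramsey graph. -/
def graph : SimpleGraph (Fin 114) where
  Adj i j := i ≠ j ∧ (row (max i.val j.val)).testBit (min i.val j.val) = true
  symm := ⟨fun i j h => ⟨h.1.symm, by rw [max_comm, min_comm]; exact h.2⟩⟩
  loopless := ⟨fun _ h => h.1 rfl⟩

theorem cliqueFree_of_free (G : SimpleGraph (Fin 114)) (nb : Nat → Nat → Nat)
    (r : Nat → Nat → Prop)
    (hnb : ∀ v u c, c.testBit u = true → r v u → (nb (row v) c).testBit u = true)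
    (hlt : ∀ a c, c < 2 ^ 114 → nb a c < 2 ^ 114)
    (hG : ∀ i j : Fin 114, j.val < i.val → G.Adj i j → r i.val j.val)
    (k : Nat) (h : free nb k (2 ^ 114 - 1) = true) : G.CliqueFree k := by
  intro s hs
  refine free_spec nb r hnb hlt k _ (by norm_num) h (s.map Fin.valEmbedding) ?_ ?_ ?_
  · rw [Finset.card_map]
    exact hs.card_eq
  · intro v hv
    obtain ⟨i, -, rfl⟩ := Finset.mem_map.1 hv
    rw [Nat.testBit_two_pow_sub_one]
    exact decide_eq_true i.isLt
  · intro v hv u hu huv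
    obtain ⟨i, hi, rfl⟩ := Finset.mem_map.1 hv
    obtain ⟨j, hj, rfl⟩ := Finset.mem_map.1 hu
    refine hG i j huv (hs.isClique hi hj ?_)
    rintro rfl
    exact lt_irrefl _ huv

theorem nbRed_testBit (r u c : Nat) :
    (nbRed r c).testBit u = (c.testBit u && r.testBit u) := by
  change (c &&& r).testBit u = _
  rw [Nat.testBit_and]

theorem nbBlue_testBit (r u c : Nat) :
    (nbBlue r c).testBit u = (c.testBit u ^^ (c.testBit u && r.testBit u)) := by
  change (c ^^^ (c &&& r)).testBit u = _
  rw [Nat.testBit_xor, Nat.testBit_and]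

theorem nbRed_lt (r c : Nat) (h : c < 2 ^ 114) : nbRed r c < 2 ^ 114 :=
  lt_of_le_of_lt (Nat.and_le_left (n := c) (m := r)) h

theorem nbBlue_lt (r c : Nat) (h : c < 2 ^ 114) : nbBlue r c < 2 ^ 114 :=
  Nat.xor_lt_two_pow h (nbRed_lt r c h)

end RamseySixSeven

open RamseySixSeven in
theorem ramsey_lower_bound_R_6_7 :
    ∃ G : SimpleGraph (Fin 114), G.CliqueFree 6 ∧ Gᶜ.CliqueFree 7 := by
  refine ⟨graph, ?_, ?_⟩
  · refine cliqueFree_of_free graph nbRed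
      (fun v u => (row v).testBit u = true) ?_ nbRed_lt ?_ 6 check_red
    · intro v u c hc hr
      rw [nbRed_testBit, hc, hr]
      rfl
    · intro i j hij h
      have h2 := h.2
      rw [max_eq_left hij.le, min_eq_right hij.le] at h2
      exact h2
  · refine cliqueFree_of_free graphᶜ nbBlue
      (fun v u => (row v).testBit u = false) ?_ nbBlue_lt ?_ 7 check_blue
    · intro v u c hc hr
      rw [nbBlue_testBit, hc, hr]
      rfl
    · intro i j hij h
      rw [SimpleGraph.compl_adj] at h
      rw [← Bool.not_eq_true]
      intro hb
      refine h.2 ⟨h.1, ?_⟩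
      rw [max_eq_left hij.le, min_eq_right hij.le]
      exact hb
end

section
/- R(3,3,6) ≥ 61; that is, there exists a 3-coloring of the edges of the complete graph K_60 containing no monochromatic K_3 in color 1, no monochromatic K_3 in color 2, and no monochromatic K_6 in color 3. -/
namespace RamseyAux

/-- Neighbourhood bit masks of the first colour. -/
def rowsA : List ℕ :=
  [38322451826874660, 76644902581056072, 153289805162111121, 306579610324222242,
   613158122210558532, 73395839325896841, 146791678651793682, 293583357303587364,
   586040815773025353, 19161226449783954, 290693295122977536, 581386590245954049,
   10977575790855171, 20830351186495494, 40535901977776140, 81071802881811480,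
   162143605763622960, 324286113089359968, 648571126667093184, 145346647561488768,
   307089784013881347, 613053669193614342, 73186932218268684, 146373864436537368,
   292747728873074736, 585494358234522720, 19193111769041088, 38386223538082176,
   76772446003471104, 153544892006941185, 165791273874489616, 331582547748979232,
   662039196663809089, 172282788626566274, 344565577253132548, 689130054995685896,
   226464505291366417, 452929010582732834, 905856922727579716, 658793439287246984,
   432667175679976224, 865333252922065473, 577746100748910723, 3696596797817094,
   7393193595634188, 13661586796052505, 27323173591057458, 54646347181067364,
   108166794456340680, 216333587839988112, 328776595148378656, 657552091857822785,
   163308579015641218, 326617158031282436, 653233216551985672, 154670828403965969,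
   309341656807931938, 617557414782763076, 82194423396566152, 164388846793132304]

/-- Neighbourhood bit masks of the second colour. -/
def rowsB : List ℕ :=
  [149771077047500880, 299542154093954208, 599084308187908416, 46373011674764928,
   92746022275788033, 185492044551576066, 369859287634195461, 738593774873176074,
   325391945046347796, 650783890092695592, 580980054356475994, 10164504012947636,
   20327909588009320, 40655819176018640, 81311638350988705, 162622178264091458,
   325244355454441093, 649363909440973067, 145807413786726934, 290490027178237997,
   1225140579008592, 2450281158017184, 4899463878148416, 9798927755249280,
   18473054041541889, 36946108083083778, 72767414698258437, 144408930563416074,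
   288817861126832148, 576510921858449448, 622064648619855873, 91207793706606594,
   182415587413213188, 364831173753733128, 729662347507466256, 307529090313880608,
   615058180627761216, 78320756555518080, 155516711642080512, 311032324846275072,
   40620635357839552, 81241269641938304, 162481440844943104, 324962880616144385,
   648800959764379651, 145806314828754950, 290487828189601804, 580975656379203608,
   10155708058402864, 20310317678919776, 579029385413396745, 6263166126789138,
   11401531857314853, 22801965276743754, 45603930553487508, 90081962273874216,
   180163924547748432, 360327849095495841, 720655698190991682, 289514693243045508]

/-- Applies `p` to the filtered tails of a list. -/
def chk {α : Type} (adj : α → α → Bool) (p : List α → Bool) (l : List α) : Bool :=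
  List.rec true (fun v l ih => Bool.rec false ih (p (List.filter (adj v) l))) l

/-- `noK adj k l`: the list `l` has no sublist of length `k` which is a clique for `adj`. -/
def noK {α : Type} (adj : α → α → Bool) (k : ℕ) : List α → Bool :=
  Nat.rec (fun _ => false) (fun _ ih => chk adj ih) k

theorem chk_cons {α : Type} (adj : α → α → Bool) (p : List α → Bool) (v : α) (l : List α) :
    chk adj p (v :: l) = (p (l.filter (adj v)) && chk adj p l) := by
  change (Bool.rec false (chk adj p l) (p (List.filter (adj v) l)) : Bool) = _
  cases p (List.filter (adj v) l) <;> rfl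

theorem noK_sound {α : Type} (adj : α → α → Bool) (k : ℕ) :
    ∀ l : List α, noK adj k l = true →
      ∀ s : List α, s.Sublist l → s.length = k → ¬ s.Pairwise (fun a b => adj a b = true) := by
  induction k with
  | zero => intro l h; exact absurd h (by simp [noK])
  | succ k ih =>
    intro l
    induction l with
    | nil =>
      intro _ s hs hl
      rw [List.sublist_nil.mp hs] at hl
      simp at hl
    | cons v l ihl =>
      intro h s hs hl hp
      have h' : (noK adj k (l.filter (adj v)) && noK adj (k + 1) l) = true := by
        rw [← h]; exact (chk_cons adj (noK adj k) v l).symm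
      rw [Bool.and_eq_true] at h'
      cases hs with
      | cons _ hs => exact ihl h'.2 s hs hl hp
      | cons_cons _ hs =>
        rename_i t
        rw [List.pairwise_cons] at hp
        refine ih _ h'.1 t ?_ (by simpa using hl) hp.2
        have : t.filter (adj v) = t := List.filter_eq_self.mpr hp.1
        rw [← this]
        exact hs.filter _

/-- Vertex data: the bit of the vertex and a neighbourhood mask. -/
def adjM (x y : ℕ × ℕ) : Bool := Bool.not (Nat.beq (Nat.land x.2 y.1) 0)

/-- Colour of an ordered pair. -/
def col (u v : Fin 60) : Fin 3 :=
  if Nat.testBit (rowsA.getD u 0) v then 0 else if Nat.testBit (rowsB.getD u 0) v then 1 else 2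

theorem col_symm : ∀ u v, col u v = col v u := by decide +kernel

/-- Neighbourhood mask of vertex `u` in colour `c`. -/
def mask (c : Fin 3) (u : Fin 60) : ℕ :=
  match c with
  | 0 => rowsA.getD u 0
  | 1 => rowsB.getD u 0
  | 2 => (2 ^ 60 - 1) - (rowsA.getD u 0 + rowsB.getD u 0 + 2 ^ u.val)

theorem mask_spec : ∀ (c : Fin 3) (u v : Fin 60), u ≠ v → col u v = c →
    adjM (2 ^ u.val, mask c u) (2 ^ v.val, mask c v) = true := by decide +kernel

/-- Explicit vertex data for colour 0. -/
def listA : List (ℕ × ℕ) :=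
  [(1, 38322451826874660), (2, 76644902581056072), (4, 153289805162111121),
   (8, 306579610324222242), (16, 613158122210558532), (32, 73395839325896841),
   (64, 146791678651793682), (128, 293583357303587364), (256, 586040815773025353),
   (512, 19161226449783954), (1024, 290693295122977536), (2048, 581386590245954049),
   (4096, 10977575790855171), (8192, 20830351186495494), (16384, 40535901977776140),
   (32768, 81071802881811480), (65536, 162143605763622960), (131072, 324286113089359968),
   (262144, 648571126667093184), (524288, 145346647561488768), (1048576, 307089784013881347),
   (2097152, 613053669193614342), (4194304, 73186932218268684), (8388608, 146373864436537368),
   (16777216, 292747728873074736), (33554432, 585494358234522720), (67108864, 19193111769041088),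
   (134217728, 38386223538082176), (268435456, 76772446003471104), (536870912, 153544892006941185),
   (1073741824, 165791273874489616), (2147483648, 331582547748979232), (4294967296, 662039196663809089),
   (8589934592, 172282788626566274), (17179869184, 344565577253132548), (34359738368, 689130054995685896),
   (68719476736, 226464505291366417), (137438953472, 452929010582732834), (274877906944, 905856922727579716),
   (549755813888, 658793439287246984), (1099511627776, 432667175679976224), (2199023255552, 865333252922065473),
   (4398046511104, 577746100748910723), (8796093022208, 3696596797817094), (17592186044416, 7393193595634188),
   (35184372088832, 13661586796052505), (70368744177664, 27323173591057458), (140737488355328, 54646347181067364),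
   (281474976710656, 108166794456340680), (562949953421312, 216333587839988112), (1125899906842624, 328776595148378656),
   (2251799813685248, 657552091857822785), (4503599627370496, 163308579015641218), (9007199254740992, 326617158031282436),
   (18014398509481984, 653233216551985672), (36028797018963968, 154670828403965969), (72057594037927936, 309341656807931938),
   (144115188075855872, 617557414782763076), (288230376151711744, 82194423396566152), (576460752303423488, 164388846793132304)]

theorem listA_eq : (List.finRange 60).map (fun u => (2 ^ u.val, mask 0 u)) = listA := by
  decide +kernel

theorem noK_listA : noK adjM 3 listA = true := by decide +kernel

/-- Explicit vertex data for colour 1. -/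
def listB : List (ℕ × ℕ) :=
  [(1, 149771077047500880), (2, 299542154093954208), (4, 599084308187908416),
   (8, 46373011674764928), (16, 92746022275788033), (32, 185492044551576066),
   (64, 369859287634195461), (128, 738593774873176074), (256, 325391945046347796),
   (512, 650783890092695592), (1024, 580980054356475994), (2048, 10164504012947636),
   (4096, 20327909588009320), (8192, 40655819176018640), (16384, 81311638350988705),
   (32768, 162622178264091458), (65536, 325244355454441093), (131072, 649363909440973067),
   (262144, 145807413786726934), (524288, 290490027178237997), (1048576, 1225140579008592),
   (2097152, 2450281158017184), (4194304, 4899463878148416), (8388608, 9798927755249280),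
   (16777216, 18473054041541889), (33554432, 36946108083083778), (67108864, 72767414698258437),
   (134217728, 144408930563416074), (268435456, 288817861126832148), (536870912, 576510921858449448),
   (1073741824, 622064648619855873), (2147483648, 91207793706606594), (4294967296, 182415587413213188),
   (8589934592, 364831173753733128), (17179869184, 729662347507466256), (34359738368, 307529090313880608),
   (68719476736, 615058180627761216), (137438953472, 78320756555518080), (274877906944, 155516711642080512),
   (549755813888, 311032324846275072), (1099511627776, 40620635357839552), (2199023255552, 81241269641938304),
   (4398046511104, 162481440844943104), (8796093022208, 324962880616144385), (17592186044416, 648800959764379651),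
   (35184372088832, 145806314828754950), (70368744177664, 290487828189601804), (140737488355328, 580975656379203608),
   (281474976710656, 10155708058402864), (562949953421312, 20310317678919776), (1125899906842624, 579029385413396745),
   (2251799813685248, 6263166126789138), (4503599627370496, 11401531857314853), (9007199254740992, 22801965276743754),
   (18014398509481984, 45603930553487508), (36028797018963968, 90081962273874216), (72057594037927936, 180163924547748432),
   (144115188075855872, 360327849095495841), (288230376151711744, 720655698190991682), (576460752303423488, 289514693243045508)]

theorem listB_eq : (List.finRange 60).map (fun u => (2 ^ u.val, mask 1 u)) = listB := by
  decide +kernel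

theorem noK_listB : noK adjM 3 listB = true := by decide +kernel

/-- Explicit vertex data for colour 2. -/
def listC : List (ℕ × ℕ) :=
  [(1, 964827975732471434), (2, 776734447931836693), (4, 400547391256827434),
   (8, 799968882607859797), (16, 447017360120500394), (32, 894033620729374036),
   (64, 636270538320857768), (128, 120744372430083409), (256, 241488743787473570),
   (512, 482976388064366917), (1024, 281248155127392421), (2048, 561370410347943242),
   (4096, 1121616019227978388), (8192, 1091435334244324649), (16384, 1031073964278065746),
   (32768, 909227523460911269), (65536, 665533543388717386), (131072, 179271482076382868),
   (262144, 358542964152764713), (524288, 717084829866595922), (1048576, 844606580012908460),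
   (2097152, 537417554253118297), (4194304, 1074835108506235571), (8388608, 996748712406671719),
   (16777216, 841700721675453134), (33554432, 530481038255686045), (67108864, 1060960978072438586),
   (134217728, 970126350371130997), (268435456, 787331197208108267), (536870912, 422865690204585430),
   (1073741824, 365065581038759662), (2147483648, 730131161003777501), (4294967296, 308466716234857402),
   (8589934592, 615807533636612981), (17179869184, 78693562666378987), (34359738368, 156262324937542103),
   (68719476736, 311398749968242606), (137438953472, 621671600029642589), (274877906944, 91547595359279803),
   (549755813888, 183095190717511031), (1099511627776, 679632594057403423), (2199023255552, 206344783019587646),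
   (4398046511104, 412689564966482044), (8796093022208, 824253231099863288), (17592186044416, 496709759060788720),
   (35184372088832, 993418418609950688), (70368744177664, 835040134082010049), (140737488355328, 517158763558220675),
   (281474976710656, 1034317527115392775), (562949953421312, 915714649134517775), (1125899906842624, 243989624138228950),
   (2251799813685248, 486854446808549804), (4503599627370496, 973707794106520408), (9007199254740992, 794495182044079793),
   (18014398509481984, 436069958991891811), (36028797018963968, 872139916910042822), (72057594037927936, 591358329213238669),
   (144115188075855872, 30921052652732186), (288230376151711744, 61841006867577397), (576460752303423488, 122557212267245675)]

theorem listC_eq : (List.finRange 60).map (fun u => (2 ^ u.val, mask 2 u)) = listC := by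
  decide +kernel

theorem noK_listC : noK adjM 6 listC = true := by decide +kernel

theorem no_clique (c : Fin 3) (k : ℕ) (L : List (ℕ × ℕ))
    (hL : (List.finRange 60).map (fun u => (2 ^ u.val, mask c u)) = L)
    (h : noK adjM k L = true) :
    ¬ ∃ S : Finset (Fin 60), S.card = k ∧ ∀ u ∈ S, ∀ v ∈ S, u ≠ v → col u v = c := by
  rintro ⟨S, hS, hc⟩
  let t := (List.finRange 60).filter (fun u => decide (u ∈ S))
  have hnd : t.Nodup := (List.nodup_finRange 60).filter _
  have hmem : ∀ u, u ∈ t ↔ u ∈ S := by intro u; simp [t]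
  have hlen : t.length = k := by
    rw [← hS, ← List.toFinset_card_of_nodup hnd]
    congr 1
    ext u
    simp [hmem]
  subst hL
  refine noK_sound adjM k _ h (t.map (fun u => (2 ^ u.val, mask c u)))
    (List.filter_sublist.map _) (by simpa using hlen) ?_
  rw [List.pairwise_map]
  refine List.Pairwise.imp_of_mem ?_ hnd
  intro u v hu hv huv
  exact mask_spec c u v huv (hc u ((hmem u).1 hu) v ((hmem v).1 hv) huv)

end RamseyAux

theorem ramsey_lower_bound_R_3_3_6 :
    ∃ f : Sym2 (Fin 60) → Fin 3,
      (¬ ∃ S : Finset (Fin 60), S.card = 3 ∧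
          ∀ u ∈ S, ∀ v ∈ S, u ≠ v → f s(u, v) = 0) ∧
      (¬ ∃ S : Finset (Fin 60), S.card = 3 ∧
          ∀ u ∈ S, ∀ v ∈ S, u ≠ v → f s(u, v) = 1) ∧
      (¬ ∃ S : Finset (Fin 60), S.card = 6 ∧
          ∀ u ∈ S, ∀ v ∈ S, u ≠ v → f s(u, v) = 2) := by
  refine ⟨Sym2.lift ⟨RamseyAux.col, RamseyAux.col_symm⟩, ?_, ?_, ?_⟩
  · exact RamseyAux.no_clique 0 3 _ RamseyAux.listA_eq RamseyAux.noK_listA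
  · exact RamseyAux.no_clique 1 3 _ RamseyAux.listB_eq RamseyAux.noK_listB
  · exact RamseyAux.no_clique 2 6 _ RamseyAux.listC_eq RamseyAux.noK_listC
end

section
/- R(3,4,7) ≥ 152; that is, there exists a 3-coloring of the edges of the complete graph K_151 containing no monochromatic K_3 in color 1, no monochromatic K_4 in color 2, and no monochromatic K_7 in color 3. -/
namespace RamseyR347

/-- Bit `d` of this mask is set when the edges of length `d` get colour 0. -/
def maskA : ℕ := 1787772778835715956551079664350871451865535498

/-- Bit `d` of this mask is set when the edges of length `d` get colour 1. -/
def maskB : ℕ := 5602446124586509277238182718382325581349376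

/-- Bit `d` of this mask is set when the edges of length `d` get colour 2. -/
def maskC : ℕ := 1061120160451617296288254091829736495318608372

/-- If the result is `true`, the set of bits of `c` contains no clique of size `k` of the distance graph of `M`. -/
noncomputable def noClique (M f : ℕ) : ℕ → ℕ → Bool :=
  Nat.rec (motive := fun _ => ℕ → ℕ → Bool) (fun _ _ => false)
    (fun _ ih k c =>
      Nat.rec (motive := fun _ => Bool) false
        (fun k_p _ =>
          Nat.rec (motive := fun _ => Bool) true
            (fun c_p _ =>
              Bool.rec (motive := fun _ => Bool) false
                (ih (Nat.succ k_p) (Nat.div (Nat.land (Nat.succ c_p) c_p)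
                  (Nat.sub (Nat.succ c_p) (Nat.land (Nat.succ c_p) c_p))))
                (ih k_p (Nat.land M (Nat.div (Nat.land (Nat.succ c_p) c_p)
                  (Nat.sub (Nat.succ c_p) (Nat.land (Nat.succ c_p) c_p))))))
            c)
        k)
    f

theorem noClique_zero (M k c : ℕ) : noClique M 0 k c = false := rfl

theorem noClique_size_zero (M f c : ℕ) : noClique M (f + 1) 0 c = false := rfl

theorem noClique_step (M f k c : ℕ) (h : noClique M (f + 1) (k + 1) (c + 1) = true) :
    noClique M f k (M &&& (((c + 1) &&& c) / ((c + 1) - ((c + 1) &&& c)))) = true ∧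
      noClique M f (k + 1) (((c + 1) &&& c) / ((c + 1) - ((c + 1) &&& c))) = true := by
  have h_p : Bool.rec (motive := fun _ => Bool) false
      (noClique M f (k + 1) (((c + 1) &&& c) / ((c + 1) - ((c + 1) &&& c))))
      (noClique M f k (M &&& (((c + 1) &&& c) / ((c + 1) - ((c + 1) &&& c))))) = true := h
  revert h_p
  cases noClique M f k (M &&& (((c + 1) &&& c) / ((c + 1) - ((c + 1) &&& c)))) <;> simp

/-- Clearing the lowest set bit. -/
theorem lowest_bit (c : ℕ) : ∃ v m : ℕ, c + 1 = 2 ^ (v + 1) * m + 2 ^ v ∧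
    (c + 1) &&& c = 2 ^ (v + 1) * m := by
  obtain ⟨v, w, ⟨m, rfl⟩, hc⟩ := Nat.exists_eq_two_pow_mul_odd (Nat.succ_ne_zero c)
  have hc1 : c + 1 = 2 ^ (v + 1) * m + 2 ^ v := by
    rw [← Nat.succ_eq_add_one, hc]; ring
  have hpos : 0 < 2 ^ v := by positivity
  have hlt : 2 ^ v < 2 ^ (v + 1) := Nat.pow_lt_pow_right (by norm_num) (by omega)
  have hc0 : c = 2 ^ (v + 1) * m + (2 ^ v - 1) := by omega
  refine ⟨v, m, hc1, ?_⟩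
  rw [hc1]
  conv_lhs => rw [hc0]
  apply Nat.eq_of_testBit_eq
  intro i
  rw [Nat.testBit_and, Nat.testBit_two_pow_mul_add _ hlt,
    Nat.testBit_two_pow_mul_add _ (show 2 ^ v - 1 < 2 ^ (v + 1) by omega), Nat.testBit_two_pow_mul]
  by_cases hi : i < v + 1
  · have : ¬ (i ≥ v + 1) := by omega
    simp only [hi, if_true, this, decide_false, Bool.false_and]
    rw [Nat.testBit_two_pow, Nat.testBit_two_pow_sub_one]
    by_cases hv : v = i
    · subst hv; simp
    · simp [hv]
  · have : i ≥ v + 1 := by omega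
    simp [hi, this]

theorem noClique_sound (M : ℕ) : ∀ (f k c : ℕ), noClique M f k c = true →
    ∀ S : Finset ℕ, S.card = k → (∀ u ∈ S, c.testBit u = true) →
    (∀ u ∈ S, ∀ v ∈ S, u < v → M.testBit (v - u) = true) → False := by
  intro f
  induction f with
  | zero => intro k c h; simp [noClique_zero] at h
  | succ f ih =>
    intro k c h S hS hb hM
    match k, c with
    | 0, c => simp [noClique_size_zero] at h
    | k + 1, 0 =>
      have hne : S.Nonempty := by
        rw [← Finset.card_pos]; omega
      obtain ⟨u, hu⟩ := hne
      simpa using hb u hu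
    | k + 1, c + 1 =>
      obtain ⟨h1, h2⟩ := noClique_step M f k c h
      obtain ⟨v, m, hc, hr⟩ := lowest_bit c
      have hlow : ((c + 1) &&& c) / ((c + 1) - ((c + 1) &&& c)) = 2 * m := by
        rw [hr, hc, Nat.add_sub_cancel_left, pow_succ, mul_assoc,
          Nat.mul_div_cancel_left _ (by positivity)]
      rw [hlow] at h1 h2
      have hlt : 2 ^ v < 2 ^ (v + 1) := Nat.pow_lt_pow_right (by norm_num) (by omega)
      have hrest : ∀ u ∈ S, u ≠ v → v < u ∧ (2 * m).testBit (u - v) = true := by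
        intro u hu hne
        have hbu := hb u hu
        rw [hc, Nat.testBit_two_pow_mul_add _ hlt] at hbu
        by_cases hi : u < v + 1
        · rw [if_pos hi, Nat.testBit_two_pow] at hbu
          exact absurd (of_decide_eq_true hbu).symm hne
        · rw [if_neg hi] at hbu
          refine ⟨by omega, ?_⟩
          have he : u - v = (u - (v + 1)) + 1 := by omega
          rw [he, Nat.testBit_succ, Nat.mul_div_cancel_left _ (by norm_num), hbu]
      have hinj : ∀ T : Finset ℕ, (∀ u ∈ T, v < u) →
          (T.image (fun u => u - v)).card = T.card := by
        intro T hT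
        apply Finset.card_image_of_injOn
        intro x hx y hy hxy
        have hx_p := hT x hx
        have hy_p := hT y hy
        simp only at hxy
        omega
      have hsub : ∀ T : Finset ℕ, T ⊆ S → (∀ u ∈ T, v < u) →
          ∀ x ∈ T.image (fun u => u - v), ∀ y ∈ T.image (fun u => u - v), x < y →
          M.testBit (y - x) = true := by
        intro T hTS hT x hx y hy hxy
        obtain ⟨u, hu, rfl⟩ := Finset.mem_image.1 hx
        obtain ⟨w, hw, rfl⟩ := Finset.mem_image.1 hy
        have hu_p := hT u hu
        have hw_p := hT w hw
        rw [← hM u (hTS hu) w (hTS hw) (by omega)]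
        congr 1
        omega
      by_cases hvS : v ∈ S
      · have hT : ∀ u ∈ S.erase v, v < u := fun u hu =>
          (hrest u (Finset.mem_of_mem_erase hu) (Finset.ne_of_mem_erase hu)).1
        refine ih k _ h1 ((S.erase v).image (fun u => u - v)) ?_ ?_
          (hsub _ (Finset.erase_subset _ _) hT)
        · rw [hinj _ hT, Finset.card_erase_of_mem hvS, hS]; rfl
        · intro x hx
          obtain ⟨u, hu, rfl⟩ := Finset.mem_image.1 hx
          obtain ⟨hne, hu⟩ := Finset.mem_erase.1 hu
          obtain ⟨hlt_p, hbit⟩ := hrest u hu hne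
          rw [Nat.testBit_and, hbit, hM v hvS u hu hlt_p]
          rfl
      · have hne : ∀ u ∈ S, u ≠ v := fun u hu hh => hvS (hh ▸ hu)
        have hT : ∀ u ∈ S, v < u := fun u hu => (hrest u hu (hne u hu)).1
        refine ih (k + 1) _ h2 (S.image (fun u => u - v)) ?_ ?_
          (hsub _ (Finset.Subset.refl _) hT)
        · rw [hinj _ hT, hS]
        · intro x hx
          obtain ⟨u, hu, rfl⟩ := Finset.mem_image.1 hx
          exact (hrest u hu (hne u hu)).2

/-- The colour of an edge of length `d`. -/
def colour (d : ℕ) : Fin 3 :=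
  if maskA.testBit d then 0 else if maskB.testBit d then 1 else 2

/-- The colouring: the colour of an edge depends on its length only. -/
def colouring : Sym2 (Fin 151) → Fin 3 :=
  Sym2.lift ⟨fun u v => colour ((u.val - v.val) + (v.val - u.val)), fun u v => by
    simp only [add_comm]⟩

theorem colour_mask : ∀ d < 151, 0 < d →
    (colour d = 0 → maskA.testBit d = true) ∧
    (colour d = 1 → maskB.testBit d = true) ∧
    (colour d = 2 → maskC.testBit d = true) := by
  decide +kernel

theorem no_mono (M k : ℕ) (i : Fin 3)
    (hcol : ∀ d < 151, 0 < d → colour d = i → M.testBit d = true)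
    (hgo : noClique M 400 k M = true) :
    ¬ ∃ S : Finset (Fin 151), S.card = k + 1 ∧
      ∀ u ∈ S, ∀ v ∈ S, u ≠ v → colouring s(u, v) = i := by
  rintro ⟨S, hS, hmono⟩
  have hne : S.Nonempty := by
    rw [← Finset.card_pos]; omega
  have key : ∀ u ∈ S, ∀ v ∈ S, u.val < v.val → M.testBit (v.val - u.val) = true := by
    intro u hu v hv huv
    have h := hmono u hu v hv (fun hh => by rw [hh] at huv; exact lt_irrefl _ huv)
    have h_p : colour ((u.val - v.val) + (v.val - u.val)) = i := h
    have hz : (u.val - v.val) + (v.val - u.val) = v.val - u.val := by omega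
    rw [hz] at h_p
    exact hcol _ (by omega) (by omega) h_p
  set m := S.min' hne with hm
  have hmS : m ∈ S := S.min'_mem hne
  have hmin : ∀ u ∈ S, m.val ≤ u.val := fun u hu => S.min'_le u hu
  have hinj : Set.InjOn (fun u : Fin 151 => u.val - m.val) (S.erase m : Finset (Fin 151)) := by
    intro u hu w hw huw
    have h1 := hmin u (Finset.mem_of_mem_erase hu)
    have h2 := hmin w (Finset.mem_of_mem_erase hw)
    have h3 := m.isLt
    simp only at huw
    apply Fin.ext
    omega
  refine noClique_sound M 400 k M hgo
    ((S.erase m).image (fun u : Fin 151 => u.val - m.val)) ?_ ?_ ?_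
  · rw [Finset.card_image_of_injOn hinj, Finset.card_erase_of_mem hmS, hS]; rfl
  · intro x hx
    obtain ⟨u, hu, rfl⟩ := Finset.mem_image.1 hx
    obtain ⟨hne_p, hu⟩ := Finset.mem_erase.1 hu
    have h1 := hmin u hu
    have h2 : u.val ≠ m.val := fun hh => hne_p (Fin.ext hh)
    have h3 := m.isLt
    have h4 := key m hmS u hu (by omega)
    exact h4
  · intro x hx y hy hxy
    obtain ⟨u, hu, rfl⟩ := Finset.mem_image.1 hx
    obtain ⟨w, hw, rfl⟩ := Finset.mem_image.1 hy
    have hu := Finset.mem_of_mem_erase hu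
    have hw := Finset.mem_of_mem_erase hw
    have h1 := hmin u hu
    have h2 := hmin w hw
    have h3 := m.isLt
    rw [← key u hu w hw (by omega)]
    congr 1
    omega

theorem checkA : noClique maskA 400 2 maskA = true := by
  decide +kernel

theorem checkB : noClique maskB 400 3 maskB = true := by
  decide +kernel

theorem checkC : noClique maskC 400 6 maskC = true := by
  decide +kernel

end RamseyR347

theorem ramsey_lower_bound_R_3_4_7 :
    ∃ f : Sym2 (Fin 151) → Fin 3,
      (¬ ∃ S : Finset (Fin 151), S.card = 3 ∧
          ∀ u ∈ S, ∀ v ∈ S, u ≠ v → f s(u, v) = 0) ∧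
      (¬ ∃ S : Finset (Fin 151), S.card = 4 ∧
          ∀ u ∈ S, ∀ v ∈ S, u ≠ v → f s(u, v) = 1) ∧
      (¬ ∃ S : Finset (Fin 151), S.card = 7 ∧
          ∀ u ∈ S, ∀ v ∈ S, u ≠ v → f s(u, v) = 2) := by
  exact ⟨RamseyR347.colouring,
    RamseyR347.no_mono RamseyR347.maskA 2 0
      (fun d hd h0 => (RamseyR347.colour_mask d hd h0).1) RamseyR347.checkA,
    RamseyR347.no_mono RamseyR347.maskB 3 1
      (fun d hd h0 => (RamseyR347.colour_mask d hd h0).2.1) RamseyR347.checkB,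
    RamseyR347.no_mono RamseyR347.maskC 6 2
      (fun d hd h0 => (RamseyR347.colour_mask d hd h0).2.2) RamseyR347.checkC⟩
end
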